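/- arXiv:2112.05460 — 5 statements merged into one kernel-verified Lean document; each statement's English description precedes it below -/
import Mathlib

section
/- Let n ≥ 6 and k ∈ {3, ..., n−3}. If an n-tournament is k-spectrally monomorphic, then it is transitive. -/
open Polynomial Matrix

/-- An `n`-tournament given by its adjacency matrix: entries in `{0,1}`, zero diagonal,
and `A + Aᵀ = J - I` where `J` is the all-ones matrix. -/
def IsTournament {n : ℕ} (A : Matrix (Fin n) (Fin n) ℚ) : Prop :=
  (∀ i j, A i j = 0 ∨ A i j = 1) ∧ (∀ i, A i i = 0) ∧
    A + Aᵀ = Matrix.of (fun _ _ => (1 : ℚ)) - 1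

/-- Transitivity of the dominance relation. -/
def IsTransitive {n : ℕ} (A : Matrix (Fin n) (Fin n) ℚ) : Prop :=
  ∀ i j k, A i j = 1 → A j k = 1 → A i k = 1

/-- `A` is `k`-spectrally monomorphic: all `k × k` principal submatrices of `A`
have the same characteristic polynomial. -/
def SpecMono {n : ℕ} (k : ℕ) (A : Matrix (Fin n) (Fin n) ℚ) : Prop :=
  ∀ f g : Fin k → Fin n, Function.Injective f → Function.Injective g →
    (A.submatrix f f).charpoly = (A.submatrix g g).charpoly

/-- If a function on `r`-subsets takes the same value after any single exchange, it is constant. -/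
lemma const_of_exchange {α : Type*} [DecidableEq α] (U : Finset α) (r : ℕ) (f : Finset α → ℚ)
    (h : ∀ x ∈ U, ∀ y ∈ U, x ≠ y → ∀ T ⊆ U, T.card = r → x ∉ T → y ∉ T →
      f (insert x T) = f (insert y T)) :
    ∀ (m : ℕ) (S T : Finset α), S ⊆ U → T ⊆ U → S.card = r + 1 → T.card = r + 1 →
      (S \ T).card = m → f S = f T := by
  intro m
  induction m with
  | zero =>
    intro S T hS hT hSc hTc hm
    have h1 : S ⊆ T := by
      rw [← Finset.sdiff_eq_empty_iff_subset]; exact Finset.card_eq_zero.mp hm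
    rw [Finset.eq_of_subset_of_card_le h1 (by omega)]
  | succ m ih =>
    intro S T hS hT hSc hTc hm
    obtain ⟨x, hx⟩ : (S \ T).Nonempty := by
      rw [← Finset.card_pos]; omega
    have hcomm : (T \ S).card = (S \ T).card := by
      have := Finset.card_sdiff_add_card_inter S T
      have h2 := Finset.card_sdiff_add_card_inter T S
      rw [Finset.inter_comm] at h2
      omega
    obtain ⟨y, hy⟩ : (T \ S).Nonempty := by
      rw [← Finset.card_pos]; omega
    rw [Finset.mem_sdiff] at hx hy
    have hxy : x ≠ y := by rintro rfl; exact hx.2 hy.1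
    have e1 : f S = f (insert y (S.erase x)) := by
      have := h x (hS hx.1) y (hT hy.1) hxy (S.erase x)
        ((Finset.erase_subset _ _).trans hS) (by rw [Finset.card_erase_of_mem hx.1]; omega)
        (Finset.notMem_erase _ _) (fun hh => hy.2 (Finset.mem_of_mem_erase hh))
      rwa [Finset.insert_erase hx.1] at this
    rw [e1]
    apply ih _ _ _ hT _ hTc
    · have : insert y (S.erase x) \ T = (S \ T).erase x := by
        ext z; simp only [Finset.mem_sdiff, Finset.mem_insert, Finset.mem_erase]
        constructor
        · rintro ⟨rfl | hz, hzT⟩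
          · exact absurd hy.1 hzT
          · exact ⟨hz.1, hz.2, hzT⟩
        · rintro ⟨a, b, c⟩; exact ⟨Or.inr ⟨a, b⟩, c⟩
      rw [this, Finset.card_erase_of_mem (Finset.mem_sdiff.mpr hx)]; omega
    · intro z hz
      rcases Finset.mem_insert.mp hz with rfl | hz
      · exact hT hy.1
      · exact hS (Finset.mem_of_mem_erase hz)
    · rw [Finset.card_insert_of_notMem (fun hh => hy.2 (Finset.mem_of_mem_erase hh)),
        Finset.card_erase_of_mem hx.1]; omega

lemma sum_powersetCard_insert {α : Type*} [DecidableEq α] (r : ℕ) (f : Finset α → ℚ)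
    (x : α) (R : Finset α) (hx : x ∉ R) :
    ∑ T ∈ (insert x R).powersetCard (r + 1), f T =
      ∑ T ∈ R.powersetCard (r + 1), f T + ∑ T ∈ R.powersetCard r, f (insert x T) := by
  rw [Finset.powersetCard_succ_insert hx, Finset.sum_union, Finset.sum_image]
  · intro S hS T hT hST
    have h1 : x ∉ S := fun h => hx ((Finset.mem_powersetCard.mp hS).1 h)
    have h2 : x ∉ T := fun h => hx ((Finset.mem_powersetCard.mp hT).1 h)
    rw [← Finset.erase_insert h1, ← Finset.erase_insert h2]
    exact congrArg (fun Q => Finset.erase Q x) hST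
  · rw [Finset.disjoint_left]
    intro S hS hS'
    obtain ⟨T, -, rfl⟩ := Finset.mem_image.mp hS'
    exact hx ((Finset.mem_powersetCard.mp hS).1 (Finset.mem_insert_self _ _))

/-- Injectivity of the inclusion matrix of `r`-subsets versus `k`-subsets. -/
lemma inclusion_injective {α : Type*} [DecidableEq α] (r : ℕ) :
    ∀ (k : ℕ) (U : Finset α) (f : Finset α → ℚ), r ≤ k → r + k ≤ U.card →
      (∀ S ⊆ U, S.card = k → ∑ T ∈ S.powersetCard r, f T = 0) →
      ∀ T ⊆ U, T.card = r → f T = 0 := by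
  induction r with
  | zero =>
    intro k U f _ hU h T hT hTc
    obtain ⟨S, hS, hSc⟩ := Finset.exists_subset_card_eq (show k ≤ U.card by omega)
    have := h S hS hSc
    rw [Finset.powersetCard_zero, Finset.sum_singleton] at this
    rwa [Finset.card_eq_zero.mp hTc]
  | succ r ih =>
    intro k U f hrk hU h T hT hTc
    obtain ⟨k, rfl⟩ : ∃ k', k = k' + 1 := ⟨k - 1, by omega⟩
    have hex : ∀ x ∈ U, ∀ y ∈ U, x ≠ y → ∀ T ⊆ U, T.card = r → x ∉ T → y ∉ T →
        f (insert x T) = f (insert y T) := by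
      intro x hx y hy hxy T hT hTc hxT hyT
      rw [← sub_eq_zero]
      refine ih k ((U.erase x).erase y) (fun T => f (insert x T) - f (insert y T)) (by omega)
        ?_ ?_ T ?_ hTc
      · rw [Finset.card_erase_of_mem (Finset.mem_erase.mpr ⟨hxy.symm, hy⟩),
          Finset.card_erase_of_mem hx]; omega
      · intro S hS hSc
        have hxS : x ∉ S := fun hh => by have := hS hh; simp at this
        have hyS : y ∉ S := fun hh => by have := hS hh; simp at this
        have hSU : S ⊆ U := hS.trans ((Finset.erase_subset _ _).trans (Finset.erase_subset _ _))
        have h1 := h (insert x S) (Finset.insert_subset hx hSU)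
          (by rw [Finset.card_insert_of_notMem hxS, hSc])
        have h2 := h (insert y S) (Finset.insert_subset hy hSU)
          (by rw [Finset.card_insert_of_notMem hyS, hSc])
        rw [sum_powersetCard_insert _ _ _ _ hxS] at h1
        rw [sum_powersetCard_insert _ _ _ _ hyS] at h2
        rw [Finset.sum_sub_distrib]
        linarith
      · intro z hz
        simp only [Finset.mem_erase]
        exact ⟨fun e => hyT (e ▸ hz), fun e => hxT (e ▸ hz), hT hz⟩
    have hconst := const_of_exchange U r f hex
    obtain ⟨S, hS, hSc⟩ := Finset.exists_subset_card_eq (show k + 1 ≤ U.card by omega)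
    have hs := h S hS hSc
    rw [Finset.sum_congr rfl (g := fun _ => f T)] at hs
    · rw [Finset.sum_const, Finset.card_powersetCard, hSc, nsmul_eq_mul] at hs
      rcases mul_eq_zero.mp hs with h0 | h0
      · have := Nat.choose_pos hrk
        norm_cast at h0
        omega
      · exact h0
    · intro Q hQ
      rw [Finset.mem_powersetCard] at hQ
      exact hconst _ Q T (hQ.1.trans hS) hT hQ.2 hTc rfl

/-- The principal minor on a finite set. -/
noncomputable def pmin {n : ℕ} (A : Matrix (Fin n) (Fin n) ℚ) (T : Finset (Fin n)) : ℚ :=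
  (A.submatrix (Subtype.val : T → Fin n) (Subtype.val : T → Fin n)).det

lemma pmin_map {n k : ℕ} (A : Matrix (Fin n) (Fin n) ℚ) (f : Fin k ↪ Fin n) (s : Finset (Fin k)) :
    pmin A (s.map f) = ((A.submatrix f f).submatrix (Subtype.val : s → Fin k)
      (Subtype.val : s → Fin k)).det := by
  unfold pmin
  let e : s ≃ (s.map f : Finset (Fin n)) := Equiv.ofBijective
    (fun x => ⟨f x.1, Finset.mem_map_of_mem f x.2⟩) (by
      constructor
      · intro x y hxy
        exact Subtype.ext (f.injective (congrArg Subtype.val hxy))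
      · rintro ⟨y, hy⟩
        obtain ⟨x, hx, rfl⟩ := Finset.mem_map.mp hy
        exact ⟨⟨x, hx⟩, rfl⟩)
  rw [← Matrix.det_submatrix_equiv_self e]
  rfl

lemma coeff_eq {n k : ℕ} (hk : 3 ≤ k) (A : Matrix (Fin n) (Fin n) ℚ) (f : Fin k ↪ Fin n) :
    (A.submatrix f f).charpoly.coeff (k - 3) =
      - ∑ T ∈ (Finset.univ.map f).powersetCard 3, pmin A T := by
  have h := Matrix.charpoly_coeff_eq_sum_minors (A.submatrix f f) 3 (by simpa using hk)
  rw [Fintype.card_fin] at h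
  rw [h, Finset.powersetCard_map, Finset.sum_map]
  simp only [Finset.mapEmbedding_apply, pmin_map, RelEmbedding.coe_toEmbedding]
  ring

lemma pmin_three {n : ℕ} (A : Matrix (Fin n) (Fin n) ℚ) (hd : ∀ i, A i i = 0)
    (a b c : Fin n) (hab : a ≠ b) (hac : a ≠ c) (hbc : b ≠ c) :
    pmin A {a, b, c} = A a b * A b c * A c a + A a c * A b a * A c b := by
  have hinj : Function.Injective ![a, b, c] := by
    intro i j hij
    fin_cases i <;> fin_cases j <;> simp_all
  have hm : ({a, b, c} : Finset (Fin n)) = Finset.univ.map ⟨![a, b, c], hinj⟩ := by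
    ext x; simp [Fin.exists_fin_succ, eq_comm]
  rw [hm, pmin_map]
  rw [← Matrix.det_submatrix_equiv_self
    (Equiv.subtypeUnivEquiv (fun x => Finset.mem_univ x)).symm, Matrix.submatrix_submatrix,
    Matrix.submatrix_submatrix, Matrix.det_fin_three]
  simp only [Matrix.submatrix_apply]
  change A a a * A b b * A c c - A a a * A b c * A c b - A a b * A b a * A c c +
    A a b * A b c * A c a + A a c * A b a * A c b - A a c * A b b * A c a = _
  simp only [hd]
  ring

theorem stmt_0 (n k : ℕ) (hn : 6 ≤ n) (hk3 : 3 ≤ k) (hkn : k ≤ n - 3)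
    (A : Matrix (Fin n) (Fin n) ℚ) (hT : IsTournament A) (hS : SpecMono k A) :
    IsTransitive A := by
  obtain ⟨h01, hd, hsum⟩ := hT
  have hadd : ∀ i j, i ≠ j → A i j + A j i = 1 := by
    intro i j hij
    have := congrFun (congrFun hsum i) j
    simpa [Matrix.one_apply_ne hij] using this
  -- constant sums
  obtain ⟨c, hc⟩ : ∃ c : ℚ, ∀ S : Finset (Fin n), S.card = k →
      ∑ T ∈ S.powersetCard 3, pmin A T = c := by
    let g : Fin k ↪ Fin n := Fin.castLEEmb (by omega)
    refine ⟨∑ T ∈ (Finset.univ.map g).powersetCard 3, pmin A T, fun S hSc => ?_⟩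
    let f : Fin k ↪ Fin n := (S.orderEmbOfFin hSc).toEmbedding
    have hf : Finset.univ.map f = S := by
      simp [f]
    have := congrArg (fun p => p.coeff (k - 3)) (hS f g f.injective g.injective)
    simp only [coeff_eq hk3] at this
    rw [hf] at this
    linarith
  have hch : ((k.choose 3 : ℕ) : ℚ) ≠ 0 := by
    have := Nat.choose_pos hk3
    positivity
  have hall : ∀ T : Finset (Fin n), T.card = 3 → pmin A T = c / (k.choose 3 : ℕ) := by
    intro T hTc
    rw [← sub_eq_zero]
    refine inclusion_injective 3 k Finset.univ (fun T => pmin A T - c / (k.choose 3 : ℕ)) hk3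
      (by simp; omega) ?_ T (Finset.subset_univ _) hTc
    intro S _ hSc
    rw [Finset.sum_sub_distrib, hc S hSc, Finset.sum_const, Finset.card_powersetCard, hSc,
      nsmul_eq_mul]
    field_simp
    ring
  have hall3 : ∀ a b c' : Fin n, a ≠ b → a ≠ c' → b ≠ c' →
      A a b * A b c' * A c' a + A a c' * A b a * A c' b = c / (k.choose 3 : ℕ) := by
    intro a b c' h1 h2 h3
    rw [← pmin_three A hd a b c' h1 h2 h3]
    exact hall _ (Finset.card_eq_three.mpr ⟨a, b, c', h1, h2, h3, rfl⟩)
  intro i j l hij hjl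
  have nij : i ≠ j := by rintro rfl; rw [hd] at hij; norm_num at hij
  have njl : j ≠ l := by rintro rfl; rw [hd] at hjl; norm_num at hjl
  have hji : A j i = 0 := by linarith [hadd i j nij]
  have hlj : A l j = 0 := by linarith [hadd j l njl]
  have nil : i ≠ l := by rintro rfl; rw [hij] at hlj; norm_num at hlj
  by_contra hil
  have hil0 : A i l = 0 := (h01 i l).resolve_right hil
  have hli : A l i = 1 := by linarith [hadd i l nil]
  obtain ⟨d, hd'⟩ : ∃ d, d ∉ ({i, j, l} : Finset (Fin n)) := by
    by_contra! hh
    have h1 := Finset.card_le_card (show (Finset.univ : Finset (Fin n)) ⊆ {i, j, l} from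
      fun x _ => hh x)
    have h2 := Finset.card_le_three (a := i) (b := j) (c := l)
    simp at h1
    omega
  simp only [Finset.mem_insert, Finset.mem_singleton, not_or] at hd'
  obtain ⟨ndi, ndj, ndl⟩ := hd'
  have e0 := hall3 i j l nij nil njl
  have e1 := hall3 i j d nij (Ne.symm ndi) (Ne.symm ndj)
  have e2 := hall3 j l d njl (Ne.symm ndj) (Ne.symm ndl)
  rw [← e0] at e1 e2
  have e3 := hadd j d (Ne.symm ndj)
  simp only [hij, hjl, hli, hji, hlj, hil0] at e1 e2
  rcases h01 j d with h | h
  · simp [h] at e1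
  · have : A d j = 0 := by linarith
    simp [this] at e2
end

section
/- Let n ≥ 5. An n-tournament is (n−2)-spectrally monomorphic if and only if it is transitive or doubly regular. -/
open Polynomial Matrix

/-- `A` is doubly regular: every pair of distinct vertices jointly dominates exactly
`t` vertices, i.e. every off-diagonal entry of `A * Aᵀ` equals `t`. -/
def IsDoublyRegular {n : ℕ} (A : Matrix (Fin n) (Fin n) ℚ) : Prop :=
  ∃ t : ℕ, ∀ i j, i ≠ j → (A * Aᵀ) i j = t

/-- `A` is regular: every row sums to `(n - 1) / 2`. -/
def IsRegularTournament {n : ℕ} (A : Matrix (Fin n) (Fin n) ℚ) : Prop :=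
  ∀ i, ∑ j, A i j = ((n : ℚ) - 1) / 2


lemma eval_charpoly_cube {m : Type*} [Fintype m] [DecidableEq m] (M : Matrix m m ℂ) (w : ℂ)
    (hw : 1 + w + w ^ 2 = 0) (y : ℂ) :
    (M ^ 3).charpoly.eval (y ^ 3) =
      M.charpoly.eval y * (w ^ Fintype.card m * M.charpoly.eval (w ^ 2 * y)) *
        ((w ^ 2) ^ Fintype.card m * M.charpoly.eval (w * y)) := by
  have hw3 : w ^ 3 = 1 := by linear_combination (w - 1) * hw
  simp only [Matrix.eval_charpoly]
  have h1 : ∀ z : ℂ, ∀ N : Matrix m m ℂ, z ^ Fintype.card m * N.det = (z • N).det := by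
    intro z N; rw [Matrix.det_smul]
  rw [h1, h1, ← Matrix.det_mul, ← Matrix.det_mul]
  congr 1
  have hs : ∀ z : ℂ, Matrix.scalar m z = z • (1 : Matrix m m ℂ) := by
    intro z; simp [Matrix.smul_one_eq_diagonal]
  simp only [hs, smul_sub, smul_smul, sub_mul, mul_sub, smul_mul_assoc, mul_smul_comm, one_mul,
    mul_one, pow_succ, pow_zero]
  have e1 : w * w = -1 - w := by linear_combination hw
  have e2 : w * (w * w) = 1 := by linear_combination hw3
  match_scalars <;> grind

lemma charpoly_cube_eq {m : Type*} [Fintype m] [DecidableEq m] (M N : Matrix m m ℂ)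
    (h : M.charpoly = N.charpoly) : (M ^ 3).charpoly = (N ^ 3).charpoly := by
  obtain ⟨s, hs⟩ := IsAlgClosed.exists_eq_mul_self (-3 : ℂ)
  have hw : 1 + ((-1 + s) / 2) + ((-1 + s) / 2) ^ 2 = 0 := by linear_combination (-1/4) * hs
  apply Polynomial.funext
  intro r
  obtain ⟨y, hy⟩ := IsAlgClosed.exists_pow_nat_eq r (n := 3) (by norm_num)
  rw [← hy, eval_charpoly_cube M _ hw, eval_charpoly_cube N _ hw, h]

lemma trace_cube_eq {m : Type*} [Fintype m] [DecidableEq m] (M N : Matrix m m ℚ)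
    (h : M.charpoly = N.charpoly) : (M ^ 3).trace = (N ^ 3).trace := by
  have h2 := charpoly_cube_eq (M.map (algebraMap ℚ ℂ)) (N.map (algebraMap ℚ ℂ)) (by
    rw [Matrix.charpoly_map, Matrix.charpoly_map, h])
  have h3 : ∀ K : Matrix m m ℚ, (K.map (algebraMap ℚ ℂ)) ^ 3 = (K ^ 3).map (algebraMap ℚ ℂ) := by
    intro K
    exact (map_pow (RingHom.mapMatrix (algebraMap ℚ ℂ)) K 3).symm
  have h4 := congrArg (fun p => -p.coeff (Fintype.card m - 1)) h2
  rcases isEmpty_or_nonempty m with hm | hm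
  · simp [Matrix.trace]
  · simp only [← Matrix.trace_eq_neg_charpoly_coeff] at h4
    rw [h3, h3, ← RingHom.mapMatrix_apply, ← RingHom.mapMatrix_apply] at h4
    have h5 : ∀ K : Matrix m m ℚ, Matrix.trace ((algebraMap ℚ ℂ).mapMatrix K) =
        algebraMap ℚ ℂ K.trace := by
      intro K; simp [Matrix.trace]
    rw [h5, h5] at h4
    exact (algebraMap ℚ ℂ).injective h4

lemma trace_cube_sum {m : Type*} [Fintype m] [DecidableEq m] (M : Matrix m m ℚ) :
    (M ^ 3).trace = ∑ i, ∑ j, ∑ k, M i j * M j k * M k i := by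
  simp only [Matrix.trace, Matrix.diag, pow_succ, pow_zero, one_mul, Matrix.mul_apply,
    Finset.sum_mul]
  refine Finset.sum_congr rfl fun i _ => ?_
  rw [Finset.sum_comm]

section
variable {n : ℕ} {A : Matrix (Fin n) (Fin n) ℚ}

lemma tour_add (hT : IsTournament A) (i j : Fin n) :
    A i j + A j i = 1 - if i = j then 1 else 0 := by
  have := congrFun (congrFun hT.2.2 i) j
  simpa [Matrix.one_apply] using this

lemma tour_mul (hT : IsTournament A) (i j : Fin n) : A i j * A j i = 0 := by
  have h := tour_add hT i j
  rcases hT.1 i j with h1 | h1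
  · rw [h1, zero_mul]
  · rcases hT.1 j i with h2 | h2
    · rw [h2, mul_zero]
    · exfalso
      rw [h1, h2] at h
      split_ifs at h <;> norm_num at h

lemma tour_sq (hT : IsTournament A) (i j : Fin n) : A i j * A i j = A i j := by
  rcases hT.1 i j with h1 | h1 <;> rw [h1] <;> norm_num

lemma tour_nonneg (hT : IsTournament A) (i j : Fin n) : 0 ≤ A i j := by
  rcases hT.1 i j with h1 | h1 <;> rw [h1] <;> norm_num

/-- transitive direction -/
lemma trans_mono (hT : IsTournament A) (hA : IsTransitive A) (k : ℕ) : SpecMono k A := by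
  classical
  have key : ∀ f : Fin k → Fin n, (A.submatrix f f).charpoly = X ^ k := by
    intro f
    let b : Fin n → ℕ := fun i => (Finset.univ.filter (fun j => A i j = 1)).card
    have hb : ∀ i j, A i j ≠ 0 → b j < b i := by
      intro i j h
      have h1 : A i j = 1 := (hT.1 i j).resolve_left h
      apply Finset.card_lt_card
      rw [Finset.ssubset_iff_of_subset]
      · exact ⟨j, by simp [h1], by simp [hT.2.1 j]⟩
      · intro l hl
        simp only [Finset.mem_filter, Finset.mem_univ, true_and] at *
        exact hA i j l h1 hl
    have hp : ∀ p i j, ((A.submatrix f f) ^ p) i j ≠ 0 → b (f j) + p ≤ b (f i) := by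
      intro p
      induction p with
      | zero =>
        intro i j h
        by_cases hij : i = j
        · subst hij; simp
        · simp [hij] at h
      | succ p ih =>
        intro i j h
        rw [pow_succ, Matrix.mul_apply] at h
        obtain ⟨l, _, hl⟩ := Finset.exists_ne_zero_of_sum_ne_zero h
        have h1 := ih i l (left_ne_zero_of_mul hl)
        have h2 := hb _ _ (right_ne_zero_of_mul hl)
        omega
    have hnil : IsNilpotent (A.submatrix f f) := by
      refine ⟨n + 1, ?_⟩
      ext i j
      by_contra h
      have h1 := hp _ i j h
      have h2 : b (f i) ≤ n := by
        simpa using Finset.card_le_univ (Finset.univ.filter (fun j => A (f i) j = 1))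
      omega
    have := Matrix.isNilpotent_charpoly_sub_pow_of_isNilpotent hnil
    have := this.eq_zero
    rw [sub_eq_zero] at this
    simpa using this
  intro f g _ _
  rw [key, key]

/-- doubly regular tournaments are regular -/
lemma dr_regular (hn : 5 ≤ n) (hT : IsTournament A) (t : ℕ)
    (ht : ∀ i j, i ≠ j → (A * Aᵀ) i j = t) (v : Fin n) : ∑ j, A v j = 2 * t + 1 := by
  have ht' : ∀ i j, i ≠ j → ∑ k, A i k * A j k = t := by
    intro i j h
    simpa [Matrix.mul_apply] using ht i j h
  have h1 : ∀ v, (∑ j, A v j) * ((∑ j, A v j) - (2 * t + 1)) = 0 := by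
    intro v
    have e1 : ∑ i, A v i * ∑ k, A v k * A i k = ∑ i, A v i * t := by
      refine Finset.sum_congr rfl fun i _ => ?_
      by_cases h : v = i
      · subst h; simp [hT.2.1]
      · rw [ht' v i h]
    have e2 : ∑ i, A v i * ∑ k, A v k * A i k = ∑ i, A v i * ∑ k, A v k * A k i := by
      simp only [Finset.mul_sum]
      rw [Finset.sum_comm]
      refine Finset.sum_congr rfl fun i _ => Finset.sum_congr rfl fun k _ => by ring
    have e3 : ∑ i, A v i * ∑ k, A v k * A i k + ∑ i, A v i * ∑ k, A v k * A k i =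
        (∑ i, A v i) * (∑ i, A v i) - ∑ i, A v i := by
      rw [← Finset.sum_add_distrib, Finset.sum_mul, ← Finset.sum_sub_distrib]
      refine Finset.sum_congr rfl fun i _ => ?_
      rw [← mul_add, ← Finset.sum_add_distrib]
      have : ∀ k, A v k * A i k + A v k * A k i = A v k - if i = k then A v k else 0 := by
        intro k
        rw [← mul_add, tour_add hT]; split_ifs <;> ring
      simp only [this, Finset.sum_sub_distrib]
      simp only [Finset.sum_ite_eq, Finset.mem_univ, if_true]
      rw [mul_sub, tour_sq hT]
    rw [← e2, e1, ← Finset.sum_mul] at e3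
    linear_combination -e3
  by_cases h0 : ∑ j, A v j = 0
  · exfalso
    have hz : ∀ j, A v j = 0 := by
      intro j
      exact (Finset.sum_eq_zero_iff_of_nonneg (fun j _ => tour_nonneg hT v j)).1 h0 j
        (Finset.mem_univ _)
    have ht0 : (t : ℚ) = 0 := by
      have : Nontrivial (Fin n) := Fin.nontrivial_iff_two_le.2 (by omega)
      obtain ⟨j, hj⟩ := exists_ne v
      rw [← ht' v j hj.symm]
      simp [hz]
    have hle : ∀ u, ∑ j, A u j ≤ 1 := by
      intro u
      rcases mul_eq_zero.1 (h1 u) with h | h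
      · rw [h]; norm_num
      · rw [ht0] at h; linarith
    have hs : ∑ i, ∑ j, A i j + ∑ i, ∑ j, A i j = n * n - n := by
      have hc : ∑ i, ∑ j, A i j = ∑ i, ∑ j, A j i := Finset.sum_comm
      nth_rewrite 2 [hc]
      rw [← Finset.sum_add_distrib]
      have : ∀ i, ∑ j, A i j + ∑ j, A j i = n - 1 := by
        intro i
        rw [← Finset.sum_add_distrib]
        simp only [tour_add hT, Finset.sum_sub_distrib]
        simp
      simp only [this]
      simp
    have hs2 : ∑ i, ∑ j, A i j ≤ ∑ i : Fin n, (1 : ℚ) := Finset.sum_le_sum fun i _ => hle i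
    simp at hs2
    have : (5 : ℚ) ≤ n := by exact_mod_cast hn
    nlinarith
  · have := (mul_eq_zero.1 (h1 v)).resolve_left h0
    linarith

lemma jacobi_minor {R l m : Type*} [CommRing R] [Fintype l] [Fintype m] [DecidableEq l]
    [DecidableEq m] (M P : Matrix (Fin n) (Fin n) R) (p : R) (h : M * P = p • 1)
    (e : l ⊕ m ≃ Fin n) :
    (M.submatrix (e ∘ Sum.inl) (e ∘ Sum.inl)).det * p ^ Fintype.card m =
      M.det * (P.submatrix (e ∘ Sum.inr) (e ∘ Sum.inr)).det := by
  have hM : M.submatrix e e = fromBlocks (M.submatrix (e ∘ Sum.inl) (e ∘ Sum.inl))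
      (M.submatrix (e ∘ Sum.inl) (e ∘ Sum.inr)) (M.submatrix (e ∘ Sum.inr) (e ∘ Sum.inl))
      (M.submatrix (e ∘ Sum.inr) (e ∘ Sum.inr)) := by
    ext (i | i) (j | j) <;> rfl
  have hP : P.submatrix e e = fromBlocks (P.submatrix (e ∘ Sum.inl) (e ∘ Sum.inl))
      (P.submatrix (e ∘ Sum.inl) (e ∘ Sum.inr)) (P.submatrix (e ∘ Sum.inr) (e ∘ Sum.inl))
      (P.submatrix (e ∘ Sum.inr) (e ∘ Sum.inr)) := by
    ext (i | i) (j | j) <;> rfl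
  have h1 : M.submatrix e e * P.submatrix e e = p • 1 := by
    rw [Matrix.submatrix_mul_equiv, h]
    ext i j
    simp [Matrix.one_apply]
  rw [hM, hP, fromBlocks_multiply, ← fromBlocks_one, fromBlocks_smul, fromBlocks_inj] at h1
  obtain ⟨-, h12, -, h22⟩ := h1
  rw [← Matrix.det_submatrix_equiv_self e M, hM]
  have h2 : (fromBlocks (1 : Matrix l l R) (P.submatrix (e ∘ Sum.inl) (e ∘ Sum.inr)) 0
      (P.submatrix (e ∘ Sum.inr) (e ∘ Sum.inr))).det =
      (P.submatrix (e ∘ Sum.inr) (e ∘ Sum.inr)).det := by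
    rw [det_fromBlocks_zero₂₁, det_one, one_mul]
  rw [← h2, ← det_mul, fromBlocks_multiply, h12, h22]
  simp [det_fromBlocks_zero₁₂]

lemma exists_equiv_extend {k : ℕ} (hk : k + 2 = n) (f : Fin k → Fin n)
    (hf : Function.Injective f) : ∃ e : Fin k ⊕ Fin 2 ≃ Fin n, ∀ i, e (Sum.inl i) = f i := by
  classical
  have hc : Fintype.card ((Set.range f)ᶜ : Set (Fin n)) = 2 := by
    rw [Fintype.card_compl_set, Set.card_range_of_injective hf]
    simp; omega
  refine ⟨((Equiv.ofInjective f hf).sumCongr (Fintype.equivFinOfCardEq hc).symm).trans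
    (Equiv.Set.sumCompl (Set.range f)), ?_⟩
  intro i
  simp

lemma dr_mono (hn : 5 ≤ n) (hT : IsTournament A) (hA : IsDoublyRegular A) :
    SpecMono (n - 2) A := by
  obtain ⟨t, ht⟩ := hA
  have hreg := dr_regular hn hT t ht
  have ht' : ∀ i j, i ≠ j → ∑ k, A i k * A j k = t := by
    intro i j h
    simpa [Matrix.mul_apply] using ht i j h
  set B : Matrix (Fin n) (Fin n) ℚ[X] := A.map C with hB
  set J : Matrix (Fin n) (Fin n) ℚ[X] := Matrix.of (fun _ _ => 1) with hJ
  set s : ℚ[X] := C ((t : ℚ) + 1) with hs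
  set k : ℚ[X] := C (2 * (t : ℚ) + 1) with hk
  have hBJ : B * J = k • J := by
    ext1 i j
    simp only [hB, hJ, hk, Matrix.mul_apply, Matrix.map_apply, Matrix.of_apply, mul_one,
      Matrix.smul_apply, smul_eq_mul]
    rw [← hreg i, map_sum]
  have hBB : B * B = s • J - B - s • 1 := by
    ext1 i j
    have hq : ∑ l, A i l * A l j = (t + 1) - A i j - (t + 1) * (if i = j then 1 else 0) := by
      have h1 : ∀ l, A i l * A l j = A i l - (if j = l then A i l else 0) - A i l * A j l := by
        intro l
        have := tour_add hT j l
        split_ifs at this ⊢ <;> linear_combination A i l * this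
      simp only [h1, Finset.sum_sub_distrib, hreg]
      simp only [Finset.sum_ite_eq, Finset.mem_univ, if_true]
      by_cases h : i = j
      · subst h
        simp only [tour_sq hT, hreg]; simp
      · rw [ht' i j h]; simp [h]; ring
    simp only [hB, hJ, hs, Matrix.mul_apply, Matrix.map_apply, Matrix.of_apply, mul_one,
      Matrix.smul_apply, Matrix.sub_apply, smul_eq_mul, ← map_mul, ← map_sum, hq]
    by_cases h : i = j
    · subst h; simp
    · simp [h]
  set M : Matrix (Fin n) (Fin n) ℚ[X] := charmatrix A with hMdef
  have hM : M = (X : ℚ[X]) • 1 - B := by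
    ext1 i j
    by_cases h : i = j
    · subst h; simp [hMdef, hB]
    · simp [hMdef, hB, h, charmatrix_apply_ne]
  set P : Matrix (Fin n) (Fin n) ℚ[X] := (X - k) • (B + (X + 1 : ℚ[X]) • 1) + s • J with hP
  set p : ℚ[X] := (X - k) * (X ^ 2 + X + s) with hp
  have hMP : M * P = p • 1 := by
    rw [hM, hP]
    simp only [sub_mul, mul_add, smul_add, smul_mul_assoc, mul_smul_comm, one_mul, mul_one,
      hBB, hBJ, smul_sub, smul_smul]
    match_scalars <;> ring1
  have hp0 : p ≠ 0 := by
    rw [hp]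
    refine mul_ne_zero (X_sub_C_ne_zero _) ?_
    intro h
    have := congrArg (eval 1) h
    simp only [hs, eval_add, eval_pow, eval_X, eval_C, eval_zero] at this
    have h2 : (0 : ℚ) ≤ t := by positivity
    linarith
  have key : ∀ f : Fin (n - 2) → Fin n, Function.Injective f →
      (A.submatrix f f).charpoly * p ^ 2 = M.det *
        (((X - k) * (X + 1) + s) ^ 2 - (X - k) * s - s ^ 2) := by
    intro f hf
    obtain ⟨e, he⟩ := exists_equiv_extend (by omega) f hf
    have h1 := jacobi_minor M P p hMP e
    have h2 : (M.submatrix (e ∘ Sum.inl) (e ∘ Sum.inl)).det = (A.submatrix f f).charpoly := by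
      rw [Matrix.charpoly]
      congr 1
      ext1 i j
      simp only [hMdef, submatrix_apply, Function.comp, he]
      by_cases h : i = j
      · subst h; simp
      · rw [charmatrix_apply_ne _ _ _ h, charmatrix_apply_ne _ _ _ (hf.ne h)]; rfl
    rw [h2, Fintype.card_fin] at h1
    rw [h1]
    congr 1
    rw [Matrix.det_fin_two]
    simp only [submatrix_apply, Function.comp]
    have hne : e (Sum.inr 0) ≠ e (Sum.inr 1) := by
      intro h
      simpa using e.injective h
    generalize e (Sum.inr 0) = a at hne ⊢
    generalize e (Sum.inr 1) = b at hne ⊢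
    have m1 : B a b * B b a = 0 := by
      simp only [hB, Matrix.map_apply, ← map_mul, tour_mul hT, map_zero]
    have a1 : B a b + B b a = 1 := by
      simp only [hB, Matrix.map_apply, ← map_add, tour_add hT, if_neg hne]; simp
    have z : ∀ a, B a a = 0 := by
      intro a; simp [hB, hT.2.1]
    simp only [hP, hJ, Matrix.add_apply, Matrix.smul_apply, smul_eq_mul, Matrix.of_apply, z,
      Matrix.one_apply_eq, Matrix.one_apply_ne hne, Matrix.one_apply_ne hne.symm]
    linear_combination (-(X - k) ^ 2) * m1 - (X - k) * s * a1
  intro f g hf hg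
  have := (key f hf).trans (key g hg).symm
  exact mul_right_cancel₀ (pow_ne_zero 2 hp0) this

lemma sub_sum (F : Fin n → ℚ) (a b : Fin n) (hab : a ≠ b) (f : Fin (n - 2) → Fin n)
    (hf : Function.Injective f) (hr : ∀ i, f i ≠ a ∧ f i ≠ b) :
    ∑ i, F (f i) = ∑ i, F i - F a - F b := by
  classical
  have himg : Finset.univ.image f = (Finset.univ.erase a).erase b := by
    apply Finset.eq_of_subset_of_card_le
    · intro x hx
      obtain ⟨i, -, rfl⟩ := Finset.mem_image.1 hx
      simp [hr i]
    · rw [Finset.card_image_of_injective _ hf, Finset.card_erase_of_mem (by simp [hab.symm]),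
        Finset.card_erase_of_mem (by simp)]
      simp; omega
  have h1 : ∑ i, F (f i) = ∑ x ∈ Finset.univ.image f, F x := by
    rw [Finset.sum_image (fun x _ y _ h => hf h)]
  rw [h1, himg, Finset.sum_erase_eq_sub (by simp [hab.symm]), Finset.sum_erase_eq_sub (by simp)]

lemma exists_compl (a b : Fin n) (hab : a ≠ b) : ∃ f : Fin (n - 2) → Fin n,
    Function.Injective f ∧ ∀ i, f i ≠ a ∧ f i ≠ b := by
  have hc : ((Finset.univ.erase a).erase b).card = n - 2 := by
    rw [Finset.card_erase_of_mem (by simp [hab.symm]), Finset.card_erase_of_mem (by simp)]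
    simp; omega
  refine ⟨Finset.orderEmbOfFin _ hc, (Finset.orderEmbOfFin _ hc).injective, ?_⟩
  intro i
  have := Finset.orderEmbOfFin_mem _ hc i
  simp only [Finset.mem_erase, Finset.mem_univ, and_true] at this
  exact ⟨this.2, this.1⟩

lemma trace_sub (hT : IsTournament A) (a b : Fin n) (hab : a ≠ b) (f : Fin (n - 2) → Fin n)
    (hf : Function.Injective f) (hr : ∀ i, f i ≠ a ∧ f i ≠ b) :
    ((A.submatrix f f) ^ 3).trace = ∑ i, ∑ j, ∑ k, A i j * A j k * A k i
      - 3 * ∑ j, ∑ k, A a j * A j k * A k a - 3 * ∑ j, ∑ k, A b j * A j k * A k b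
      + 3 * (∑ k, A a b * A b k * A k a + ∑ k, A b a * A a k * A k b) := by
  rw [trace_cube_sum]
  simp only [Matrix.submatrix_apply]
  rw [sub_sum (fun i => ∑ j, ∑ k, A i (f j) * A (f j) (f k) * A (f k) i) a b hab f hf hr]
  have e1 : ∀ i, ∑ j, ∑ k, A i (f j) * A (f j) (f k) * A (f k) i =
      ∑ j, ∑ k, A i j * A j k * A k i - ∑ j, A i j * A j a * A a i - ∑ j, A i j * A j b * A b i
       - (∑ k, A i a * A a k * A k i - A i a * A a a * A a i - A i a * A a b * A b i)
       - (∑ k, A i b * A b k * A k i - A i b * A b a * A a i - A i b * A b b * A b i) := by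
    intro i
    rw [sub_sum (fun j => ∑ k, A i j * A j (f k) * A (f k) i) a b hab f hf hr]
    have e2 : ∀ j, ∑ k, A i j * A j (f k) * A (f k) i =
        ∑ k, A i j * A j k * A k i - A i j * A j a * A a i - A i j * A j b * A b i := by
      intro j
      rw [sub_sum (fun k => A i j * A j k * A k i) a b hab f hf hr]
    simp only [e2, Finset.sum_sub_distrib]
  simp only [e1, Finset.sum_sub_distrib, hT.2.1, mul_zero, zero_mul, Finset.sum_const_zero]
  have z1 := tour_mul hT a b
  have c1 : ∀ c, ∑ i, ∑ j, A i j * A j c * A c i = ∑ j, ∑ k, A c j * A j k * A k c := by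
    intro c
    refine Finset.sum_congr rfl fun i _ => Finset.sum_congr rfl fun j _ => by ring
  have c2 : ∀ c, ∑ i, ∑ k, A i c * A c k * A k i = ∑ j, ∑ k, A c j * A j k * A k c := by
    intro c
    rw [Finset.sum_comm]
    refine Finset.sum_congr rfl fun i _ => Finset.sum_congr rfl fun j _ => by ring
  have c3 : ∀ c d, ∑ i, A i c * A c d * A d i = ∑ k, A c d * A d k * A k c := by
    intro c d
    refine Finset.sum_congr rfl fun i _ => by ring
  have c4 : ∀ c d, ∑ i, A c i * A i d * A d c = ∑ k, A d c * A c k * A k d := by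
    intro c d
    refine Finset.sum_congr rfl fun i _ => by ring
  have c5 : ∀ c, ∑ i, A c i * A i c * A c c = 0 := by
    intro c; simp [hT.2.1]
  simp only [c2, c3, c4]
  have z2 : ∀ x, A a b * A b a * x = 0 := by intro x; rw [z1, zero_mul]
  have z3 : ∀ x, A b a * A a b * x = 0 := by intro x; rw [mul_comm (A b a), z1, zero_mul]
  ring

lemma mono_fwd (hn : 5 ≤ n) (hT : IsTournament A) (hS : SpecMono (n - 2) A) :
    IsTransitive A ∨ IsDoublyRegular A := by
  classical
  let N : Fin n → ℚ := fun a => ∑ j, ∑ k, A a j * A j k * A k a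
  let T : Fin n → Fin n → ℚ := fun a b => ∑ k, A a b * A b k * A k a
  let NN : ℚ := ∑ i, N i
  have hnt : Nontrivial (Fin n) := Fin.nontrivial_iff_two_le.2 (by omega)
  have hnq : (5 : ℚ) ≤ n := by exact_mod_cast hn
  obtain ⟨a0, b0, hab0⟩ := exists_pair_ne (Fin n)
  -- the trace condition
  obtain ⟨c, hc⟩ : ∃ c : ℚ, ∀ a b, a ≠ b → T a b + T b a = c + N a + N b := by
    obtain ⟨g, hg, hgr⟩ := exists_compl a0 b0 hab0
    refine ⟨(((A.submatrix g g) ^ 3).trace - NN) / 3, ?_⟩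
    intro a b hab
    obtain ⟨f, hf, hfr⟩ := exists_compl a b hab
    have h1 := trace_cube_eq _ _ (hS f g hf hg)
    rw [trace_sub hT a b hab f hf hfr] at h1
    simp only [N, T, NN]
    linear_combination h1 / 3
  have hTT : ∀ a, T a a = 0 := by intro a; simp [T, hT.2.1]
  have hs1 : ∀ a, ∑ b, T a b = N a := fun a => rfl
  have hs2 : ∀ a, ∑ b, T b a = N a := by
    intro a
    simp only [T, N]
    rw [Finset.sum_comm]
    refine Finset.sum_congr rfl fun i _ => Finset.sum_congr rfl fun j _ => by ring
  have hN : ∀ a, (n - 4 : ℚ) * N a = -((n - 1) * c) - NN := by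
    intro a
    have h1 : ∑ b, (T a b + T b a) = ∑ b, ((c + N a + N b) - if a = b then c + N a + N b else 0) := by
      refine Finset.sum_congr rfl fun b _ => ?_
      by_cases h : a = b
      · subst h; simp [hTT]
      · simp [h, hc a b h]
    rw [Finset.sum_add_distrib, hs1, hs2, Finset.sum_sub_distrib, Finset.sum_add_distrib] at h1
    simp only [Finset.sum_ite_eq, Finset.mem_univ, if_true, Finset.sum_const, Finset.card_univ,
      Fintype.card_fin, nsmul_eq_mul] at h1
    simp only [NN]
    linear_combination -h1
  obtain ⟨L, hL⟩ : ∃ L : ℚ, ∀ a b, a ≠ b → T a b + T b a = L := by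
    refine ⟨c + N a0 + N a0, ?_⟩
    have hNc : ∀ a, N a = N a0 := by
      intro a
      have h0 : (n - 4 : ℚ) ≠ 0 := by linarith
      exact mul_left_cancel₀ h0 ((hN a).trans (hN a0).symm)
    intro a b hab
    rw [hc a b hab, hNc a, hNc b]
  have hnn : ∀ a b, 0 ≤ T a b := by
    intro a b
    exact Finset.sum_nonneg fun k _ => mul_nonneg (mul_nonneg (tour_nonneg hT _ _)
      (tour_nonneg hT _ _)) (tour_nonneg hT _ _)
  have hTL : ∀ a b, T a b = A a b * L := by
    intro a b
    by_cases h : a = b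
    · subst h; simp [hTT, hT.2.1]
    · rcases hT.1 a b with h1 | h1
      · simp [T, h1]
      · have h2 := tour_add hT a b
        have h3 : A b a = 0 := by rw [h1, if_neg h] at h2; linarith
        have h4 : T b a = 0 := by simp [T, h3]
        have := hL a b h
        rw [h1]; linarith
  by_cases hL0 : L = 0
  · left
    intro i j k hij hjk
    by_contra hik
    have hik0 := (hT.1 i k).resolve_right hik
    have hne : i ≠ k := by
      rintro rfl
      have := tour_mul hT i j
      rw [hij, hjk] at this; norm_num at this
    have hki : A k i = 1 := by
      have := tour_add hT i k
      rw [hik0, if_neg hne] at this; linarith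
    have h0 : T i j = 0 := by rw [hTL, hL0, mul_zero]
    have := (Finset.sum_eq_zero_iff_of_nonneg (fun k _ => mul_nonneg (mul_nonneg (tour_nonneg hT i j)
      (tour_nonneg hT j k)) (tour_nonneg hT k i))).1 h0 k (Finset.mem_univ _)
    rw [hij, hjk, hki] at this
    norm_num at this
  · right
    have hd : ∀ a, ∑ j, A a j = ((n : ℚ) - 1) / 2 := by
      intro a
      have h1 := hs1 a
      have h2 := hs2 a
      simp only [hTL, ← Finset.sum_mul] at h1 h2
      have h3 : ∑ j, A a j = ∑ j, A j a := mul_right_cancel₀ hL0 (h1.trans h2.symm)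
      have h4 : ∑ j, A a j + ∑ j, A j a = n - 1 := by
        rw [← Finset.sum_add_distrib]
        simp only [tour_add hT, Finset.sum_sub_distrib]
        simp
      linarith
    have hq1 : ∀ i j, A i j = 1 → ∑ k, A i k * A j k = ((n : ℚ) - 1) / 2 - L := by
      intro i j hij
      have hji : A j i = 0 := by
        have := tour_mul hT i j
        rwa [hij, one_mul] at this
      have h1 : ∑ k, A j k * A k i = L := by
        have := hTL i j
        simpa [T, hij] using this
      have h2 : ∀ k, A i k * A j k = A j k - (if i = k then A j k else 0) - A j k * A k i := by
        intro k
        have := tour_add hT i k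
        split_ifs at this ⊢ <;> linear_combination A j k * this
      simp only [h2, Finset.sum_sub_distrib, hd, h1]
      simp [hji]
    have hq : ∀ i j, i ≠ j → ∑ k, A i k * A j k = ((n : ℚ) - 1) / 2 - L := by
      intro i j hij
      rcases hT.1 i j with h1 | h1
      · have : A j i = 1 := by
          have := tour_add hT i j
          rw [h1, if_neg hij] at this; linarith
        rw [← hq1 j i this]
        exact Finset.sum_congr rfl fun k _ => mul_comm _ _
      · exact hq1 i j h1
    obtain ⟨t, ht⟩ : ∃ t : ℕ, ∑ k, A a0 k * A b0 k = t := by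
      have : ∀ k, ∃ m : ℕ, A a0 k * A b0 k = m := by
        intro k
        rcases hT.1 a0 k with h1 | h1 <;> rcases hT.1 b0 k with h2 | h2
        · exact ⟨0, by simp [h1]⟩
        · exact ⟨0, by simp [h1]⟩
        · exact ⟨0, by simp [h2]⟩
        · exact ⟨1, by simp [h1, h2]⟩
      choose m hm using this
      exact ⟨∑ k, m k, by simp [hm]⟩
    refine ⟨t, ?_⟩
    intro i j hij
    rw [← ht, hq a0 b0 hab0, ← hq i j hij]
    simp [Matrix.mul_apply]

end

theorem stmt_1 (n : ℕ) (hn : 5 ≤ n) (A : Matrix (Fin n) (Fin n) ℚ)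
    (hT : IsTournament A) :
    SpecMono (n - 2) A ↔ (IsTransitive A ∨ IsDoublyRegular A) := by
  constructor
  · exact mono_fwd hn hT
  · rintro (h | h)
    · exact trans_mono hT h _
    · exact dr_mono hn hT h
end

section
/- Let T be a doubly regular n-tournament (n ≥ 5). Then the characteristic polynomial of every (n−2)×(n−2) principal submatrix of its adjacency matrix equals (z² + z + (n+1)/4)^((n−5)/2) · (z³ − ((n−5)/2)z² − ((n−5)/2)z − (n−3)/4). -/
open Polynomial Matrix

lemma dr_facts {n : ℕ} (hn : 5 ≤ n) (A : Matrix (Fin n) (Fin n) ℚ)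
    (hT : IsTournament A) (t : ℕ) (ht : ∀ i j, i ≠ j → (A * Aᵀ) i j = t) :
    n = 4 * t + 3 ∧ ∀ i, ∑ j, A i j = 2 * t + 1 := by
  obtain ⟨h01, h0, hA⟩ := hT
  have hadd : ∀ i j, A i j + A j i = 1 - (1 : Matrix (Fin n) (Fin n) ℚ) i j := by
    intro i j
    have := congrFun (congrFun hA i) j
    simpa using this
  have hsq : ∀ i j, A i j * A i j = A i j := by
    intro i j
    rcases h01 i j with h | h <;> simp [h]
  have key : ∀ i, (∑ j, A i j) * (∑ j, A i j) - ∑ j, A i j = 2 * (t * ∑ j, A i j) := by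
    intro i
    have e1 : ∑ j, A i j * (A * Aᵀ) i j = t * ∑ j, A i j := by
      rw [Finset.mul_sum]
      refine Finset.sum_congr rfl fun j _ => ?_
      by_cases hij : i = j
      · subst hij; simp [h0]
      · rw [ht i j hij, mul_comm]
    have e2 : ∑ j, A i j * (A * Aᵀ) i j = ∑ j, ∑ k, A i j * A i k * A j k := by
      refine Finset.sum_congr rfl fun j _ => ?_
      rw [Matrix.mul_apply, Finset.mul_sum]
      refine Finset.sum_congr rfl fun k _ => ?_
      simp [mul_assoc]
    have e3 : ∑ j, ∑ k, A i j * A i k * A j k = ∑ j, ∑ k, A i j * A i k * A k j := by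
      rw [Finset.sum_comm]
      refine Finset.sum_congr rfl fun j _ => Finset.sum_congr rfl fun k _ => ?_
      ring
    have e4 : ∑ j, ∑ k, A i j * A i k * A j k + ∑ j, ∑ k, A i j * A i k * A k j
        = (∑ j, A i j) * (∑ j, A i j) - ∑ j, A i j := by
      rw [← Finset.sum_add_distrib, Finset.sum_mul_sum, ← Finset.sum_sub_distrib]
      refine Finset.sum_congr rfl fun j _ => ?_
      rw [← Finset.sum_add_distrib]
      have : ∀ k, A i j * A i k * A j k + A i j * A i k * A k j
          = A i j * A i k - (if j = k then A i j * A i k else 0) := by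
        intro k
        rw [← mul_add, hadd, Matrix.one_apply]
        split_ifs <;> ring
      rw [Finset.sum_congr rfl fun k _ => this k, Finset.sum_sub_distrib]
      simp [hsq]
    rw [← e4, ← e3, ← e2, e1]; ring
  have tot : 2 * ∑ i, ∑ j, A i j = (n : ℚ) * n - n := by
    have e : ∑ i, ∑ j, A i j = ∑ i, ∑ j, A j i := Finset.sum_comm
    calc 2 * ∑ i, ∑ j, A i j = ∑ i, ∑ j, A i j + ∑ i, ∑ j, A j i := by rw [← e]; ring
      _ = ∑ i : Fin n, ∑ j : Fin n, (1 - (1 : Matrix (Fin n) (Fin n) ℚ) i j) := by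
        rw [← Finset.sum_add_distrib]
        refine Finset.sum_congr rfl fun i _ => ?_
        rw [← Finset.sum_add_distrib]
        exact Finset.sum_congr rfl fun j _ => hadd i j
      _ = _ := by simp [Matrix.one_apply, mul_sub]
  have hn' : (5 : ℚ) ≤ n := by exact_mod_cast hn
  have hr : ∀ i, ∑ j, A i j = 2 * t + 1 := by
    intro i
    by_contra hne
    have hor : ∀ i, ∑ j, A i j = 0 ∨ ∑ j, A i j = 2 * t + 1 := by
      intro i
      have : (∑ j, A i j) * ((∑ j, A i j) - (2 * t + 1)) = 0 := by linarith [key i]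
      rcases mul_eq_zero.mp this with h | h
      · exact Or.inl h
      · exact Or.inr (by linarith)
    have hz : ∑ j, A i j = 0 := (hor i).resolve_right hne
    have hz' : ∀ j, A i j = 0 := by
      intro j
      refine (Finset.sum_eq_zero_iff_of_nonneg ?_).mp hz j (Finset.mem_univ _)
      intro k _
      rcases h01 i k with h | h <;> simp [h]
    have t0 : (t : ℚ) = 0 := by
      haveI : Nontrivial (Fin n) := Fin.nontrivial_iff_two_le.mpr (by omega)
      obtain ⟨j, hj⟩ := exists_ne i
      rw [← ht i j hj.symm, Matrix.mul_apply]
      simp [hz']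
    have le : ∑ i, ∑ j, A i j ≤ ∑ i : Fin n, (1 : ℚ) := by
      refine Finset.sum_le_sum fun i _ => ?_
      rcases hor i with h | h <;> rw [h] <;> simp [t0]
    simp at le
    nlinarith
  refine ⟨?_, hr⟩
  rw [Finset.sum_congr rfl fun i _ => hr i] at tot
  simp at tot
  have : (n : ℚ) = 4 * t + 3 := by
    have h : (n : ℚ) * (n - (4 * t + 3)) = 0 := by linarith
    rcases mul_eq_zero.mp h with h | h <;> linarith
  exact_mod_cast this

/-- determinant of `q I - s J`. -/
lemma det_qJ {ι : Type*} [Fintype ι] [DecidableEq ι] (q s : ℚ[X]) (m : ℕ)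
    (hm : Fintype.card ι = m + 1) :
    (q • (1 : Matrix ι ι ℚ[X]) - s • Matrix.of (fun _ _ => (1 : ℚ[X]))).det
      = q ^ m * (q - (m + 1 : ℕ) * s) := by
  have h : (q • (1 : Matrix ι ι ℚ[X]) - s • Matrix.of (fun _ _ => (1 : ℚ[X])))
      = (vecMulVec (fun _ : ι => s) (fun _ : ι => (1 : ℚ[X]))).charmatrix.map (Polynomial.eval q) := by
    ext1 i j
    by_cases hij : i = j
    · subst hij; simp [charmatrix, vecMulVec]
    · simp [charmatrix, vecMulVec, hij]
  have h2 := (Polynomial.evalRingHom q).map_det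
    (vecMulVec (fun _ : ι => s) (fun _ : ι => (1 : ℚ[X]))).charmatrix
  rw [h]
  have h3 : ((vecMulVec (fun _ : ι => s) (fun _ : ι => (1 : ℚ[X]))).charpoly).eval q
    = q ^ m * (q - (m + 1 : ℕ) * s) := by
    rw [Matrix.charpoly_vecMulVec]
    simp [hm, dotProduct, pow_succ]
    ring
  rw [← h3]
  exact h2.symm

lemma key_block {m k : Type*} [Fintype m] [DecidableEq m] [Fintype k] [DecidableEq k]
    {R : Type*} [CommRing R] (M N : Matrix (m ⊕ k) (m ⊕ k) R) (d : R)
    (h : M * N = d • (1 : Matrix (m ⊕ k) (m ⊕ k) R)) :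
    M.det * N.toBlocks₂₂.det = M.toBlocks₁₁.det * d ^ Fintype.card k := by
  have e : M * fromBlocks 1 N.toBlocks₁₂ 0 N.toBlocks₂₂
      = fromBlocks M.toBlocks₁₁ 0 M.toBlocks₂₁ (d • 1) := by
    rw [← fromBlocks_toBlocks M, ← fromBlocks_toBlocks N, fromBlocks_multiply,
      ← fromBlocks_one, fromBlocks_smul, fromBlocks_inj] at h
    obtain ⟨-, h12, -, h22⟩ := h
    conv_lhs => rw [← fromBlocks_toBlocks M]
    rw [fromBlocks_multiply]
    simp only [toBlocks_fromBlocks₁₂, toBlocks_fromBlocks₂₂, h12, h22]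
    simp
  have := congrArg Matrix.det e
  rw [det_mul, det_fromBlocks_zero₂₁, det_fromBlocks_zero₁₂] at this
  simpa using this

theorem stmt_2 (n : ℕ) (hn : 5 ≤ n) (A : Matrix (Fin n) (Fin n) ℚ)
    (hT : IsTournament A) (hDR : IsDoublyRegular A)
    (f : Fin (n - 2) → Fin n) (hf : Function.Injective f) :
    (A.submatrix f f).charpoly =
      (X ^ 2 + X + C (((n : ℚ) + 1) / 4)) ^ ((n - 5) / 2) *
        (X ^ 3 - C (((n : ℚ) - 5) / 2) * X ^ 2 - C (((n : ℚ) - 5) / 2) * X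
          - C (((n : ℚ) - 3) / 4)) := by
  obtain ⟨t, ht⟩ := hDR
  obtain ⟨hnt, hr⟩ := dr_facts hn A hT t ht
  obtain ⟨h01, h0, hA⟩ := hT
  have hadd : ∀ i j, A i j + A j i = 1 - (1 : Matrix (Fin n) (Fin n) ℚ) i j := by
    intro i j
    have := congrFun (congrFun hA i) j
    simpa using this
  -- the equivalence
  obtain ⟨e, he⟩ : ∃ e : Fin (n - 2) ⊕ Fin 2 ≃ Fin n, ∀ i, e (Sum.inl i) = f i := by
    classical
    have hc : Fintype.card (↑(Set.range f)ᶜ : Type) = 2 := by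
      rw [Fintype.card_compl_set, Set.card_range_of_injective hf]
      simp; omega
    refine ⟨(Equiv.sumCongr (Equiv.ofInjective f hf)
      (Fintype.equivFinOfCardEq hc).symm).trans (Equiv.Set.sumCompl _), fun i => ?_⟩
    simp
  -- quadratic relation
  have hJ : ∀ i j, (A * A) i j + A i j
      = (t + 1) * (1 - (1 : Matrix (Fin n) (Fin n) ℚ) i j) := by
    intro i j
    have hat : Aᵀ = Matrix.of (fun _ _ => (1 : ℚ)) - 1 - A := by rw [← hA]; abel
    have h1 : (A * Aᵀ) i j = (2 * t + 1) - A i j - (A * A) i j := by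
      rw [hat, mul_sub, mul_sub]
      simp [Matrix.mul_apply, hr]
    by_cases hij : i = j
    · subst hij
      have h2 : (A * Aᵀ) i i = 2 * t + 1 := by
        rw [Matrix.mul_apply, ← hr i]
        refine Finset.sum_congr rfl fun k _ => ?_
        rcases h01 i k with h | h <;> simp [h]
      simp; linarith
    · have := ht i j hij
      simp [hij]; linarith
  set J : Matrix (Fin n) (Fin n) ℚ[X] := Matrix.of (fun _ _ => (1 : ℚ[X])) with hJd
  set B : Matrix (Fin n) (Fin n) ℚ[X] := A.map C with hB
  have hq : (B * B) + B = C ((t : ℚ) + 1) • (J - 1) := by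
    ext1 i j
    have e1 : (B * B) i j = C ((A * A) i j) := by
      rw [hB, ← Matrix.map_mul]; rfl
    rw [Matrix.add_apply, e1, hB, Matrix.map_apply, ← C_add, hJ, C_mul]
    by_cases hij : i = j
    · subst hij; simp [J]
    · simp [hij, J]
  have hBJ : B * J = C (2 * (t : ℚ) + 1) • J := by
    ext1 i j
    rw [← hr i]
    simp [B, J, Matrix.mul_apply]
  have hBT : Bᵀ = J - 1 - B := by
    ext1 i j
    have := congrArg (C : ℚ → ℚ[X]) (hadd j i)
    rw [C_add, ← eq_sub_iff_add_eq'] at this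
    by_cases hij : i = j
    · subst hij; simp [B, J, h0]
    · simp [B, J, this, hij, Ne.symm hij]
  have hM : A.charmatrix = (X : ℚ[X]) • 1 - B := by
    rw [charmatrix, Matrix.scalar_apply, ← Matrix.smul_one_eq_diagonal]; rfl
  set q : ℚ[X] := X ^ 2 + X + C ((t : ℚ) + 1) with hqd
  set L : ℚ[X] := X - C (2 * (t : ℚ) + 1) with hL
  have qm : q.Monic := by rw [hqd]; monicity!
  have Lm : L.Monic := monic_X_sub_C _
  have hMJ : A.charmatrix * J = L • J := by
    rw [hM, sub_mul, hBJ, hL, sub_smul, smul_mul_assoc, one_mul]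
  have hMB : A.charmatrix * ((X + 1 : ℚ[X]) • 1 + B) = q • 1 - C ((t : ℚ) + 1) • J := by
    have hBB : B * B = C ((t : ℚ) + 1) • (J - 1) - B := by rw [← hq]; abel
    rw [hM, sub_mul, mul_add, mul_add, hBB]
    simp only [hqd, smul_mul_assoc, one_mul, mul_smul_comm, mul_one]
    module
  have hMT : A.charmatrixᵀ = (X + 1 : ℚ[X]) • 1 + B - J := by
    rw [hM, transpose_sub, hBT, transpose_smul, transpose_one]
    module
  have hdet : A.charmatrix.det = q ^ (2 * t + 1) * L := by
    have h1 : A.charmatrix * A.charmatrixᵀ = q • 1 - (X - C (t : ℚ)) • J := by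
      rw [hMT, mul_sub, hMB, hMJ, hL]
      have : (C (2 * (t : ℚ) + 1) : ℚ[X]) = C (t : ℚ) + C ((t : ℚ) + 1) := by
        rw [← C_add]; congr 1; ring
      rw [this]; module
    have h2 := congrArg Matrix.det h1
    rw [det_mul, det_transpose, det_qJ q _ (4 * t + 2) (by simp [hnt])] at h2
    have h3 : A.charmatrix.det ^ 2 = (q ^ (2 * t + 1) * L) ^ 2 := by
      rw [sq, h2, mul_pow, ← pow_mul]
      congr 1
      · congr 1; ring
      · have h2 : (C (2 : ℚ) : ℚ[X]) = 2 := rfl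
        simp [hqd, hL, h2]; ring
    have hm1 : A.charmatrix.det.Monic := A.charpoly_monic
    have hm2 : (q ^ (2 * t + 1) * L).Monic := (qm.pow _).mul Lm
    rcases sq_eq_sq_iff_eq_or_eq_neg.mp h3 with h | h
    · exact h
    · exfalso
      have := congrArg Polynomial.leadingCoeff h
      rw [leadingCoeff_neg, hm1.leadingCoeff, hm2.leadingCoeff] at this
      norm_num at this
  -- adjugate-like
  set N : Matrix (Fin n) (Fin n) ℚ[X] :=
    L • ((X + 1 : ℚ[X]) • 1 + B) + C ((t : ℚ) + 1) • J with hN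
  have hMN : A.charmatrix * N = (q * L) • 1 := by
    rw [hN, mul_add, mul_smul_comm, hMB, mul_smul_comm, hMJ]
    module
  have hMN' : A.charmatrix.submatrix e e * N.submatrix e e = (q * L) • 1 := by
    rw [Matrix.submatrix_mul_equiv, hMN]
    ext1 i j
    by_cases hij : i = j <;> simp [hij]
  have hblk := key_block _ _ _ hMN'
  have hP : (A.charmatrix.submatrix e e).toBlocks₁₁.det = (A.submatrix f f).charpoly := by
    rw [Matrix.charpoly]
    congr 1
    ext1 i j
    by_cases hij : i = j
    · simp [toBlocks₁₁, he, hij, charmatrix]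
    · have : f i ≠ f j := fun h => hij (hf h)
      simp [toBlocks₁₁, he, hij, charmatrix, this]
  rw [det_submatrix_equiv_self, hdet, hP] at hblk
  have hS : (N.submatrix e e).toBlocks₂₂.det
      = L * (L * (X + 1) ^ 2 + (2 * X + 1) * C ((t : ℚ) + 1)) := by
    rw [det_fin_two]
    have hne : e (Sum.inr 0) ≠ e (Sum.inr 1) := by simp
    have hab := hadd (e (Sum.inr 0)) (e (Sum.inr 1))
    have hc := h01 (e (Sum.inr 0)) (e (Sum.inr 1))
    simp only [Matrix.one_apply_ne hne, sub_zero] at hab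
    simp only [toBlocks₂₂, N, J, B, Matrix.submatrix_apply, Matrix.of_apply, Matrix.add_apply,
      Matrix.smul_apply, Matrix.map_apply, smul_eq_mul, Matrix.one_apply_eq, h0,
      Matrix.one_apply_ne hne, Matrix.one_apply_ne hne.symm, C_0]
    rcases hc with h | h
    · have h' : A (e (Sum.inr 1)) (e (Sum.inr 0)) = 1 := by linarith
      rw [h, h']; simp only [C_0, C_1]; ring
    · have h' : A (e (Sum.inr 1)) (e (Sum.inr 0)) = 0 := by linarith
      rw [h, h']; simp only [C_0, C_1]; ring
  rw [hS] at hblk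
  have htp : 1 ≤ t := by omega
  obtain ⟨s, rfl⟩ : ∃ s, t = s + 1 := ⟨t - 1, by omega⟩
  have hcancel : (q * L) ^ 2 ≠ 0 := pow_ne_zero _ (mul_ne_zero qm.ne_zero Lm.ne_zero)
  have hfin : (A.submatrix f f).charpoly
      = q ^ (2 * s + 1) * (L * (X + 1) ^ 2 + (2 * X + 1) * C (((s + 1 : ℕ) : ℚ) + 1)) := by
    apply mul_right_cancel₀ hcancel
    rw [Fintype.card_fin] at hblk
    rw [← hblk]; ring
  rw [hfin]
  have hexp : (n - 5) / 2 = 2 * s + 1 := by omega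
  have hnq : (n : ℚ) = 4 * (s + 1) + 3 := by rw [hnt]; push_cast; ring
  rw [hexp, hnq, hqd, hL]
  have c1 : ((4 * ((s : ℚ) + 1) + 3 + 1) / 4) = s + 2 := by ring
  have c2 : ((4 * ((s : ℚ) + 1) + 3 - 5) / 2) = 2 * s + 1 := by ring
  have c3 : ((4 * ((s : ℚ) + 1) + 3 - 3) / 4) = s + 1 := by ring
  rw [c1, c2, c3]
  push_cast
  simp only [C_add, C_mul, C_1, map_ofNat]
  ring
end

section
/- For every integer of the form n = 3^k · 7 (k ≥ 0), there exists a regular n-tournament that is not (n−1)-spectrally monomorphic. -/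
open Polynomial Matrix

/-- Equal characteristic polynomials of vertex-deleted submatrices force equal diagonal
entries of all powers. -/
lemma diag_pow_eq_of_specMono {n m : ℕ} (hnm : n = m + 1) (A : Matrix (Fin n) (Fin n) ℚ)
    (h : SpecMono (n - 1) A) (v w : Fin n) (i : ℕ) : (A ^ i) v v = (A ^ i) w w := by
  subst hnm
  set B : Matrix (Fin (m+1)) (Fin (m+1)) ℚ[X] := A.map C with hB
  set N := adjugate (1 - (X : ℚ[X]) • B) with hN
  have hdiag : ∀ u, N u u = (A.submatrix u.succAbove u.succAbove).charpolyRev := by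
    intro u
    rw [hN, adjugate_fin_succ_eq_det_submatrix, Matrix.charpolyRev]
    rw [Even.neg_one_pow ⟨_, rfl⟩, one_mul]
    congr 1
    ext1 a b
    simp [hB, Matrix.one_apply]
  have h0 : N v v = N w w := by
    rw [hdiag, hdiag, ← reverse_charpoly, ← reverse_charpoly]
    congr 1
    exact h _ _ Fin.succAbove_right_injective Fin.succAbove_right_injective
  have hmul : N * (1 - (X : ℚ[X]) • B) = A.charpolyRev • 1 := by
    rw [hN, adjugate_mul]; rfl
  have hpow : ∀ j u, (B ^ j) u u = C ((A ^ j) u u) := by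
    intro j u
    have : B ^ j = (A ^ j).map C := by
      rw [hB]
      exact (map_pow (RingHom.mapMatrix (C : ℚ →+* ℚ[X])) A j).symm
    rw [this]; rfl
  have hrec : ∀ j u, A.charpolyRev * C ((A ^ j) u u)
      = (N * B ^ j) u u - X * (N * B ^ (j+1)) u u := by
    intro j u
    have : A.charpolyRev • B ^ j = N * B ^ j - (X : ℚ[X]) • (N * B ^ (j+1)) := by
      rw [← one_mul (B ^ j), ← smul_mul_assoc, ← hmul, mul_sub, sub_mul, mul_one, one_mul,
        Matrix.mul_smul, Matrix.smul_mul, mul_assoc, pow_succ']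
    have := congrFun (congrFun this u) u
    simpa [hpow] using this
  have key : ∀ j, (N * B ^ j) v v = (N * B ^ j) w w →
      (A ^ j) v v = (A ^ j) w w ∧ (N * B ^ (j+1)) v v = (N * B ^ (j+1)) w w := by
    intro j hj
    have h1 := hrec j v
    have h2 := hrec j w
    have h3 : (A ^ j) v v = (A ^ j) w w := by
      have e1 := congrArg (eval 0) h1
      have e2 := congrArg (eval 0) h2
      simp at e1 e2
      rw [e1, e2, hj]
    refine ⟨h3, ?_⟩
    rw [h3] at h1
    have : (X : ℚ[X]) * (N * B ^ (j+1)) v v = X * (N * B ^ (j+1)) w w := by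
      rw [hj] at h1
      linear_combination h1 - h2
    exact mul_left_cancel₀ X_ne_zero this
  have all : ∀ j, (N * B ^ j) v v = (N * B ^ j) w w := by
    intro j
    induction j with
    | zero => simpa using h0
    | succ j ih => exact (key j ih).2
  exact (key i (all i)).1

/-- A regular tournament on seven vertices. -/
def seven : Matrix (Fin 7) (Fin 7) ℚ :=
  !![0, 0, 1, 0, 0, 1, 1;
     1, 0, 0, 0, 0, 1, 1;
     0, 1, 0, 0, 1, 0, 1;
     1, 1, 1, 0, 0, 0, 0;
     1, 1, 0, 1, 0, 0, 0;
     0, 0, 1, 1, 1, 0, 0;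
     0, 0, 0, 1, 1, 1, 0]

/-- The all-ones matrix of order seven. -/
def ones7 : Matrix (Fin 7) (Fin 7) ℚ := Matrix.of fun _ _ => 1

/-- The connection set of the rotational tournament. -/
def rotFun (m : ℕ) (d : ZMod m) : ℚ := if 0 < d.val ∧ 2 * d.val < m then 1 else 0

lemma rotFun_add_neg {m : ℕ} [NeZero m] (hm : Odd m) (d : ZMod m) :
    rotFun m d + rotFun m (-d) = if d = 0 then 0 else 1 := by
  unfold rotFun
  rw [ZMod.neg_val]
  have hlt := ZMod.val_lt d
  split_ifs with h1 h2 h3 h3 <;> simp_all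
  all_goals try (have := (ZMod.val_ne_zero d).2 (by assumption))
  all_goals grind

lemma rotFun_sum {m : ℕ} [NeZero m] (hm : Odd m) :
    ∑ d, rotFun m d = ((m : ℚ) - 1) / 2 := by
  have h1 : ∑ d : ZMod m, (rotFun m d + rotFun m (-d)) = (m : ℚ) - 1 := by
    simp_rw [rotFun_add_neg hm]
    have : ∀ d : ZMod m, (if d = 0 then (0:ℚ) else 1) = 1 - if d = 0 then 1 else 0 := by
      intro d; split_ifs <;> simp
    simp_rw [this]
    rw [Finset.sum_sub_distrib]
    simp
  have h2 : ∑ d : ZMod m, rotFun m (-d) = ∑ d, rotFun m d :=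
    Equiv.sum_comp (Equiv.neg (ZMod m)) (rotFun m)
  rw [Finset.sum_add_distrib, h2] at h1
  linarith

/-- The rotational tournament. -/
def rot (m : ℕ) : Matrix (ZMod m) (ZMod m) ℚ := Matrix.of fun i j => rotFun m (j - i)

open scoped Kronecker

/-- The composition of the rotational tournament with `seven`. -/
def comp7 (m : ℕ) : Matrix (ZMod m × Fin 7) (ZMod m × Fin 7) ℚ :=
  rot m ⊗ₖ ones7 + 1 ⊗ₖ seven

lemma seven_ones : seven * ones7 = (3 : ℚ) • ones7 := by
  ext i j
  fin_cases i <;> simp [Matrix.mul_apply, seven, ones7, Fin.sum_univ_succ] <;> norm_num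

lemma ones_seven : ones7 * seven = (3 : ℚ) • ones7 := by
  ext i j
  fin_cases j <;> simp [Matrix.mul_apply, seven, ones7, Fin.sum_univ_succ] <;> norm_num

lemma ones_ones : ones7 * ones7 = (7 : ℚ) • ones7 := by
  ext i j
  simp [Matrix.mul_apply, ones7]

lemma pow_ones (k : ℕ) : seven ^ k * ones7 = (3 : ℚ) ^ k • ones7 := by
  induction k with
  | zero => simp
  | succ k ih => rw [pow_succ, mul_assoc, seven_ones, Matrix.mul_smul, ih, smul_smul, pow_succ']

lemma comp7_pow (m : ℕ) [NeZero m] (k : ℕ) : ∃ P : Matrix (ZMod m) (ZMod m) ℚ,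
    comp7 m ^ k = 1 ⊗ₖ (seven ^ k) + P ⊗ₖ ones7 := by
  induction k with
  | zero => exact ⟨0, by simp⟩
  | succ k ih =>
    obtain ⟨P, hP⟩ := ih
    refine ⟨(3 : ℚ) ^ k • rot m + (7 : ℚ) • (P * rot m) + (3 : ℚ) • P, ?_⟩
    rw [pow_succ, hP, comp7, mul_add, add_mul, add_mul, ← Matrix.mul_kronecker_mul, ← Matrix.mul_kronecker_mul,
      ← Matrix.mul_kronecker_mul, ← Matrix.mul_kronecker_mul, pow_ones, ones_seven, ones_ones, ← pow_succ]
    simp only [add_kronecker, smul_kronecker, kronecker_smul, one_mul, mul_one]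
    abel

lemma seven_diag : (seven ^ 4) 0 0 ≠ (seven ^ 4) 2 2 := by
  have : seven ^ 4 = (seven * seven) * (seven * seven) := by noncomm_ring
  rw [this]
  simp [Matrix.mul_apply, seven, Fin.sum_univ_succ]
  norm_num

lemma seven_entry (i j : Fin 7) : seven i j = 0 ∨ seven i j = 1 := by
  fin_cases i <;> fin_cases j <;> simp [seven]

lemma seven_add (i j : Fin 7) : seven i j + seven j i = if i = j then 0 else 1 := by
  fin_cases i <;> fin_cases j <;> simp [seven]

lemma seven_sum (i : Fin 7) : ∑ j, seven i j = 3 := by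
  fin_cases i <;> simp [seven, Fin.sum_univ_succ] <;> norm_num

lemma comp7_apply (m : ℕ) (a b : ZMod m) (v w : Fin 7) :
    comp7 m (a, v) (b, w) = rotFun m (b - a) + if a = b then seven v w else 0 := by
  simp [comp7, rot, ones7, Matrix.one_apply]

lemma rotFun_zero (m : ℕ) : rotFun m 0 = 0 := by simp [rotFun]

lemma rotFun_entry (m : ℕ) (d : ZMod m) : rotFun m d = 0 ∨ rotFun m d = 1 := by
  unfold rotFun
  split_ifs <;> simp

theorem stmt_3 (k : ℕ) :
    ∃ A : Matrix (Fin (3 ^ k * 7)) (Fin (3 ^ k * 7)) ℚ,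
      IsTournament A ∧ IsRegularTournament A ∧ ¬ SpecMono (3 ^ k * 7 - 1) A := by
  obtain ⟨m, hm⟩ : ∃ m, m = 3 ^ k := ⟨_, rfl⟩
  have hodd : Odd m := hm ▸ Odd.pow (by decide)
  rw [← hm]
  have hpos : 0 < m := hodd.pos
  have : NeZero m := ⟨hpos.ne'⟩
  have e : Fin (m * 7) ≃ ZMod m × Fin 7 :=
    (Fintype.equivFinOfCardEq (by simp [ZMod.card])).symm
  refine ⟨(comp7 m).submatrix e e, ⟨?_, ?_, ?_⟩, ?_, ?_⟩
  · intro i j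
    rw [Matrix.submatrix_apply]
    obtain ⟨a, v⟩ := e i
    obtain ⟨b, w⟩ := e j
    rw [comp7_apply]
    by_cases hab : a = b
    · subst hab
      simpa [rotFun_zero] using seven_entry v w
    · simpa [hab] using rotFun_entry m (b - a)
  · intro i
    rw [Matrix.submatrix_apply]
    obtain ⟨a, v⟩ := e i
    have := seven_add v v
    rw [comp7_apply]
    simp only [if_true] at this
    simp only [sub_self, rotFun_zero, if_true]
    linarith
  · ext i j
    have hij : i = j ↔ e i = e j := e.injective.eq_iff.symm
    simp only [Matrix.add_apply, Matrix.transpose_apply, Matrix.submatrix_apply,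
      Matrix.sub_apply, Matrix.of_apply, Matrix.one_apply, hij]
    obtain ⟨a, v⟩ := e i
    obtain ⟨b, w⟩ := e j
    rw [comp7_apply, comp7_apply]
    by_cases hab : a = b
    · subst hab
      have := seven_add v w
      by_cases hvw : v = w <;> simp [hvw, rotFun_zero] at this ⊢ <;> exact this
    · have := rotFun_add_neg hodd (b - a)
      rw [neg_sub, if_neg (sub_ne_zero.2 (Ne.symm hab))] at this
      simp [hab, Ne.symm hab, this]
  · intro i
    simp only [Matrix.submatrix_apply]
    rw [Equiv.sum_comp e (fun y => comp7 m (e i) y)]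
    obtain ⟨a, v⟩ := e i
    rw [Fintype.sum_prod_type]
    simp only [comp7_apply, Finset.sum_add_distrib, Finset.sum_const, Finset.card_univ,
      Fintype.card_fin, nsmul_eq_mul]
    rw [← Finset.mul_sum]
    have h1 : ∑ b : ZMod m, rotFun m (b - a) = ∑ d, rotFun m d :=
      Equiv.sum_comp (Equiv.subRight a) (rotFun m)
    have h2 : ∑ b : ZMod m, ∑ w, (if a = b then seven v w else 0) = 3 := by
      rw [Finset.sum_comm]
      simp [seven_sum]
    rw [h1, h2, rotFun_sum hodd]
    push_cast
    ring
  · intro h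
    have h1 := fun v w => diag_pow_eq_of_specMono (m := m * 7 - 1) (by omega) _ h v w 4
    have h2 : ((comp7 m).submatrix e e) ^ 4 = ((comp7 m) ^ 4).submatrix e e := by
      simp [pow_succ]
    obtain ⟨P, hP⟩ := comp7_pow m 4
    have h3 := h1 (e.symm (0, 0)) (e.symm (0, 2))
    rw [h2, hP] at h3
    apply seven_diag
    simpa [ones7] using h3
end

section
/- Let n ≥ 7. An n-tournament with skew-adjacency matrix S is (n−3)-skew-spectrally monomorphic if and only if either it is switching equivalent to a transitive tournament (there exists a diagonal matrix D with diagonal entries in {1, −1} such that D·S·D is the skew-adjacency matrix of a transitive n-tournament), or S is a skew-conference matrix, i.e. Sᵀ·S = (n−1)·I. -/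
open Polynomial Matrix

/-- A tournament with adjacency matrix `A` is `k`-skew-spectrally monomorphic if all
`k × k` principal submatrices of its skew-adjacency matrix `S = A - Aᵀ` have the same
characteristic polynomial. -/
def SkewSpecMono {n : ℕ} (k : ℕ) (A : Matrix (Fin n) (Fin n) ℚ) : Prop :=
  ∀ f g : Fin k → Fin n, Function.Injective f → Function.Injective g →
    ((A - Aᵀ).submatrix f f).charpoly = ((A - Aᵀ).submatrix g g).charpoly

/-- The tournament with adjacency matrix `A` is switching equivalent to a transitive
tournament: for some `±1` diagonal matrix `D`, the matrix `D·S·D` (with `S = A - Aᵀ`)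
is the skew-adjacency matrix of a transitive tournament. -/
def SwitchEquivTransitive {n : ℕ} (A : Matrix (Fin n) (Fin n) ℚ) : Prop :=
  ∃ ε : Fin n → ℚ, (∀ i, ε i = 1 ∨ ε i = -1) ∧
    ∃ B : Matrix (Fin n) (Fin n) ℚ, IsTournament B ∧ IsTransitive B ∧
      Matrix.diagonal ε * (A - Aᵀ) * Matrix.diagonal ε = B - Bᵀ

namespace SkewMono

/-! ### Transitive direction -/

/-- The skew-adjacency matrix of the standard transitive tournament. -/
def stdTrans (k : ℕ) : Matrix (Fin k) (Fin k) ℚ :=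
  Matrix.of fun a b => if a < b then 1 else if b < a then -1 else 0

lemma tour_sum {n : ℕ} {A : Matrix (Fin n) (Fin n) ℚ} (hA : IsTournament A) {i j : Fin n}
    (hij : i ≠ j) : A i j + A j i = 1 := by
  have := congrFun (congrFun hA.2.2 i) j
  simpa [Matrix.one_apply, hij] using this

lemma trans_charpoly {n k : ℕ} {B : Matrix (Fin n) (Fin n) ℚ} (hB : IsTournament B)
    (hBt : IsTransitive B) (f : Fin k → Fin n) (hf : Function.Injective f) :
    ((B - Bᵀ).submatrix f f).charpoly = (stdTrans k).charpoly := by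
  classical
  let P : Fin k → Finset (Fin k) := fun i => Finset.univ.filter fun j => B (f j) (f i) = 1
  have hself : ∀ i, i ∉ P i := by
    intro i; simp [P, hB.2.1]
  have hlt : ∀ i, (P i).card < k := by
    intro i
    have := Finset.card_lt_univ_of_notMem (hself i)
    simpa using this
  let r : Fin k → Fin k := fun i => ⟨(P i).card, hlt i⟩
  have hmono : ∀ i j, B (f i) (f j) = 1 → r i < r j := by
    intro i j h
    show (P i).card < (P j).card
    apply Finset.card_lt_card
    rw [Finset.ssubset_iff_of_subset]
    · exact ⟨i, by simpa [P] using h, hself i⟩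
    · intro l hl
      simp only [P, Finset.mem_filter, Finset.mem_univ, true_and] at hl ⊢
      exact hBt _ _ _ hl h
  have hcase : ∀ i j, i ≠ j → (B (f i) (f j) = 1 ∧ B (f j) (f i) = 0) ∨
      (B (f i) (f j) = 0 ∧ B (f j) (f i) = 1) := by
    intro i j hij
    have h := tour_sum hB (hf.ne hij)
    rcases hB.1 (f i) (f j) with h0 | h0
    · right; exact ⟨h0, by linarith⟩
    · left; exact ⟨h0, by linarith⟩
  have hinj : Function.Injective r := by
    intro i j hij
    by_contra hne
    rcases hcase i j hne with h | h
    · exact absurd hij (hmono _ _ h.1).ne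
    · exact absurd hij (hmono _ _ h.2).ne'
  let e : Fin k ≃ Fin k := Equiv.ofBijective r (Finite.injective_iff_bijective.mp hinj)
  have : (B - Bᵀ).submatrix f f = Matrix.reindex e.symm e.symm (stdTrans k) := by
    ext i j
    simp only [Matrix.submatrix_apply, Matrix.sub_apply, Matrix.transpose_apply,
      Matrix.reindex_apply, Equiv.symm_symm, stdTrans, Matrix.of_apply]
    show _ = if r i < r j then (1 : ℚ) else if r j < r i then -1 else 0
    by_cases hij : i = j
    · subst hij; simp
    rcases hcase i j hij with h | h
    · rw [if_pos (hmono _ _ h.1), h.1, h.2]; norm_num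
    · have := hmono _ _ h.2
      rw [if_neg (not_lt.mpr this.le), if_pos this, h.1, h.2]; norm_num
  rw [this, Matrix.charpoly_reindex]

lemma switch_charpoly {n k : ℕ} {A : Matrix (Fin n) (Fin n) ℚ}
    (h : SwitchEquivTransitive A) (f : Fin k → Fin n) (hf : Function.Injective f) :
    ((A - Aᵀ).submatrix f f).charpoly = (stdTrans k).charpoly := by
  obtain ⟨ε, hε, B, hB, hBt, hD⟩ := h
  rw [← trans_charpoly hB hBt f hf, ← hD]
  have hsq : ∀ i, ε i * ε i = 1 := by
    intro i; rcases hε i with h | h <;> rw [h] <;> norm_num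
  have : (Matrix.diagonal ε * (A - Aᵀ) * Matrix.diagonal ε).submatrix f f =
      Matrix.diagonal (ε ∘ f) * ((A - Aᵀ).submatrix f f * Matrix.diagonal (ε ∘ f)) := by
    ext i j
    simp [Matrix.diagonal_mul, Matrix.mul_diagonal, mul_assoc]
  rw [this, Matrix.charpoly_mul_comm, Matrix.mul_assoc, Matrix.diagonal_mul_diagonal]
  have h1 : (Matrix.diagonal fun i => (ε ∘ f) i * (ε ∘ f) i) = (1 : Matrix (Fin k) (Fin k) ℚ) := by
    simp [hsq]
  rw [h1, Matrix.mul_one]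

/-! ### Conference direction -/

lemma conf_charpoly {n k : ℕ} (hk : k + 3 = n) (S : Matrix (Fin n) (Fin n) ℚ)
    (hskew : ∀ i j, S j i = - S i j) (hpm : ∀ i j, i ≠ j → S i j * S i j = 1)
    (hC : S * S = -(((n : ℚ) - 1) • (1 : Matrix (Fin n) (Fin n) ℚ)))
    (f : Fin k → Fin n) (hf : Function.Injective f) :
    (S.submatrix f f).charpoly * (X ^ 2 + C ((n : ℚ) - 1)) ^ 3 =
      S.charpoly * (X ^ 3 + 3 * X) := by
  classical
  have hdiag : ∀ i, S i i = 0 := fun i => by have := hskew i i; linarith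
  let q : ℚ[X] := X ^ 2 + C ((n : ℚ) - 1)
  have hcard : Fintype.card {x // x ∉ Set.range f} = 3 := by
    have h1 := Fintype.card_subtype_compl (fun x => x ∈ Set.range f)
    have h2 : Fintype.card {x // x ∈ Set.range f} = k := by
      have := Fintype.card_congr (Equiv.ofInjective f hf)
      rw [Fintype.card_fin] at this
      exact this.symm
    rw [h2] at h1
    rw [h1]; simp; omega
  let e3 : Fin 3 ≃ {x // x ∉ Set.range f} := (Fintype.equivFinOfCardEq hcard).symm
  let e : Fin k ⊕ Fin 3 ≃ Fin n :=
    (Equiv.sumCongr (Equiv.ofInjective f hf) e3).trans (Equiv.sumCompl (fun x => x ∈ Set.range f))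
  let g : Fin 3 → Fin n := fun i => e (Sum.inr i)
  have hg : Function.Injective g := e.injective.comp Sum.inr_injective
  have hel : ∀ i, e (Sum.inl i) = f i := fun i => rfl
  have her : ∀ i, e (Sum.inr i) = g i := fun i => rfl
  let M := S.charmatrix
  let N := (-S).charmatrix
  have hMN : M * N = q • (1 : Matrix (Fin n) (Fin n) ℚ[X]) := by
    have h1 : (S.map C) * (S.map C) = -(C ((n : ℚ) - 1) • (1 : Matrix (Fin n) (Fin n) ℚ[X])) := by
      rw [← Matrix.map_mul, hC]
      ext i j : 1
      by_cases hij : i = j <;> simp [Matrix.one_apply, hij]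
    have h2 : M * N = (Matrix.scalar (Fin n) (X : ℚ[X])) * (Matrix.scalar (Fin n) (X : ℚ[X]))
        - S.map C * S.map C := by
      have hc : Commute (Matrix.scalar (Fin n) (X : ℚ[X])) (S.map C) :=
        Matrix.scalar_commute _ (fun _ => Commute.all _ _) _
      have hN : N = Matrix.scalar (Fin n) (X : ℚ[X]) + S.map C := by
        ext i j : 1
        simp [N, Matrix.charmatrix]
      have hM : M = Matrix.scalar (Fin n) (X : ℚ[X]) - S.map C := by
        ext i j : 1
        simp [M, Matrix.charmatrix]
      rw [hM, hN, sub_mul, mul_add, mul_add, hc.eq]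
      abel
    rw [h2, h1]
    ext i j : 1
    by_cases hij : i = j <;> simp [Matrix.one_apply, hij, q] <;> ring
  let M' := M.submatrix e e
  let N' := N.submatrix e e
  have hMN' : M' * N' = q • (1 : Matrix (Fin k ⊕ Fin 3) (Fin k ⊕ Fin 3) ℚ[X]) := by
    show M.submatrix e e * N.submatrix e e = _
    rw [Matrix.submatrix_mul_equiv, hMN]
    ext i j : 1
    simp [Matrix.one_apply]
  have hblk : M'.toBlocks₁₁ * N'.toBlocks₁₂ + M'.toBlocks₁₂ * N'.toBlocks₂₂ = 0 ∧
      M'.toBlocks₂₁ * N'.toBlocks₁₂ + M'.toBlocks₂₂ * N'.toBlocks₂₂ = q • 1 := by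
    have h := hMN'
    rw [← Matrix.fromBlocks_toBlocks M', ← Matrix.fromBlocks_toBlocks N',
      Matrix.fromBlocks_multiply, ← Matrix.fromBlocks_one, Matrix.fromBlocks_smul,
      Matrix.fromBlocks_inj] at h
    exact ⟨by simpa using h.2.1, h.2.2.2⟩
  have hprod : M' * Matrix.fromBlocks 1 N'.toBlocks₁₂ 0 N'.toBlocks₂₂ =
      Matrix.fromBlocks M'.toBlocks₁₁ 0 M'.toBlocks₂₁ (q • 1) := by
    conv_lhs => rw [← Matrix.fromBlocks_toBlocks M']
    rw [Matrix.fromBlocks_multiply, hblk.1, hblk.2]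
    simp
  have hdet := congrArg Matrix.det hprod
  rw [Matrix.det_mul, Matrix.det_fromBlocks_zero₂₁, Matrix.det_fromBlocks_zero₁₂,
    Matrix.det_one, one_mul, Matrix.det_smul, Matrix.det_one, mul_one] at hdet
  have hM' : M'.det = S.charpoly := Matrix.det_submatrix_equiv_self e M
  have h11 : M'.toBlocks₁₁.det = (S.submatrix f f).charpoly := by
    unfold Matrix.charpoly
    congr 1
    ext i j : 2
    simp only [Matrix.toBlocks₁₁, Matrix.of_apply, M', Matrix.submatrix_apply, hel, M,
      Matrix.charmatrix_apply, Matrix.diagonal_apply, hf.eq_iff]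
  have h22 : N'.toBlocks₂₂.det = X ^ 3 + 3 * X := by
    have ne : ∀ i j : Fin 3, i ≠ j → (C (S (g i) (g j)) : ℚ[X]) * C (S (g i) (g j)) = 1 := by
      intro i j hij
      rw [← C_mul, hpm _ _ (hg.ne hij), C_1]
    have h01 := ne 0 1 (by decide)
    have h02 := ne 0 2 (by decide)
    have h12 := ne 1 2 (by decide)
    rw [Matrix.det_fin_three]
    simp only [Matrix.toBlocks₂₂, Matrix.of_apply, N', Matrix.submatrix_apply, her, N,
      Matrix.charmatrix_apply, Matrix.diagonal_apply, hg.eq_iff, Matrix.neg_apply]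
    rw [hskew (g 0) (g 1), hskew (g 0) (g 2), hskew (g 1) (g 2), hdiag, hdiag, hdiag]
    simp only [C_neg, C_0, neg_zero, sub_zero, neg_neg, if_true, show (0 : Fin 3) ≠ 1 by decide,
      show (0 : Fin 3) ≠ 2 by decide, show (1 : Fin 3) ≠ 2 by decide,
      show (1 : Fin 3) ≠ 0 by decide,
      show (2 : Fin 3) ≠ 0 by decide, show (2 : Fin 3) ≠ 1 by decide, if_false, zero_sub]
    linear_combination (X : ℚ[X]) * h01 + X * h02 + X * h12
  rw [hM', h11, h22] at hdet
  rw [hdet]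
  simp [q]

/-! ### The main direction: combinatorics -/

/-- Sum of a set function over the 4-subsets of `K` containing `U`. -/
def G {n : ℕ} (m : Finset (Fin n) → ℚ) (U K : Finset (Fin n)) : ℚ :=
  ∑ s ∈ (K.powersetCard 4).filter (fun s => U ⊆ s), m s

lemma G_insert {n : ℕ} (m : Finset (Fin n) → ℚ) (U K : Finset (Fin n)) (x : Fin n) :
    G m (insert x U) K = G m U K - G m U (K.erase x) := by
  classical
  unfold G
  rw [eq_sub_iff_add_eq, ← Finset.sum_union]
  · congr 1
    ext s
    simp only [Finset.mem_union, Finset.mem_filter, Finset.mem_powersetCard,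
      Finset.insert_subset_iff, Finset.subset_erase]
    tauto
  · rw [Finset.disjoint_left]
    intro s
    simp only [Finset.mem_filter, Finset.mem_powersetCard,
      Finset.insert_subset_iff, Finset.subset_erase]
    tauto

lemma G_avg {n : ℕ} (m : Finset (Fin n) → ℚ) (K : Finset (Fin n)) :
    ∑ x ∈ K, G m ∅ (K.erase x) = ((K.card : ℚ) - 4) * G m ∅ K := by
  classical
  have h : ∀ x ∈ K, G m ∅ (K.erase x) = ∑ s ∈ K.powersetCard 4, if x ∉ s then m s else 0 := by
    intro x _
    unfold G
    rw [← Finset.sum_filter]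
    congr 1
    ext s
    simp only [Finset.mem_filter, Finset.mem_powersetCard, Finset.subset_erase,
      Finset.empty_subset]
    tauto
  rw [Finset.sum_congr rfl h, Finset.sum_comm]
  unfold G
  simp only [Finset.empty_subset, Finset.filter_true]
  rw [Finset.mul_sum]
  apply Finset.sum_congr rfl
  intro s hs
  rw [Finset.mem_powersetCard] at hs
  rw [← Finset.sum_filter, Finset.sum_const, nsmul_eq_mul]
  have h1 : K.filter (fun x => x ∉ s) = K \ s := by
    ext x; simp
  rw [h1, Finset.card_sdiff_of_subset hs.1, Nat.cast_sub (Finset.card_le_card hs.1), hs.2]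
  norm_num

lemma G_up {n : ℕ} (m : Finset (Fin n) → ℚ) (c : ℕ) (hc : 4 ≤ c)
    (h : ∃ v, ∀ K : Finset (Fin n), K.card = c → G m ∅ K = v) :
    ∃ v, ∀ K : Finset (Fin n), K.card = c + 1 → G m ∅ K = v := by
  obtain ⟨v, hv⟩ := h
  refine ⟨((c : ℚ) + 1) * v / ((c : ℚ) - 3), fun K hK => ?_⟩
  have h1 := G_avg m K
  have h2 : ∑ x ∈ K, G m ∅ (K.erase x) = ∑ x ∈ K, v :=
    Finset.sum_congr rfl fun x hx => hv _ (by rw [Finset.card_erase_of_mem hx, hK]; rfl)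
  rw [h2, Finset.sum_const, hK, nsmul_eq_mul] at h1
  have h3 : (4 : ℚ) ≤ c := by exact_mod_cast hc
  rw [eq_div_iff (by linarith)]
  push_cast at h1
  linarith

lemma G_triple {n : ℕ} (hn : 7 ≤ n) (m : Finset (Fin n) → ℚ)
    (h : ∃ v, ∀ K : Finset (Fin n), K.card = n - 3 → G m ∅ K = v) :
    ∃ v, ∀ x y z : Fin n, x ≠ y → x ≠ z → y ≠ z → G m {x, y, z} Finset.univ = v := by
  obtain ⟨k, rfl⟩ : ∃ k, n = k + 3 := ⟨n - 3, by omega⟩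
  have h0 : k + 3 - 3 = k := by omega
  rw [h0] at h
  have h1 := G_up m k (by omega) h
  have h2 := G_up m (k + 1) (by omega) h1
  obtain ⟨v3, h3⟩ := h
  obtain ⟨v2, h2'⟩ := h1
  obtain ⟨v1, h1'⟩ := h2
  refine ⟨G m ∅ Finset.univ - 3 * v1 + 3 * v2 - v3, fun x y z hxy hxz hyz => ?_⟩
  have e : ({x, y, z} : Finset (Fin (k + 3))) = insert x (insert y (insert z ∅)) := by simp
  rw [e]
  simp only [G_insert]
  have c1 : ∀ a : Fin (k + 3), (Finset.univ.erase a).card = k + 1 + 1 := by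
    intro a; rw [Finset.card_erase_of_mem (Finset.mem_univ _)]; simp
  have c2 : ∀ a b : Fin (k + 3), a ≠ b → ((Finset.univ.erase a).erase b).card = k + 1 := by
    intro a b hab
    rw [Finset.card_erase_of_mem (by simp [hab.symm]), c1]; rfl
  have c3 : ((((Finset.univ : Finset (Fin (k + 3))).erase x).erase y).erase z).card = k := by
    rw [Finset.card_erase_of_mem (by simp [hxz.symm, hyz.symm]), c2 _ _ hxy]; rfl
  rw [h1' _ (c1 x), h1' _ (c1 y), h1' _ (c1 z), h2' _ (c2 _ _ hxy), h2' _ (c2 _ _ hxz),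
    h2' _ (c2 _ _ hyz), h3 _ c3]
  ring

lemma G_triple_eq {n : ℕ} (m : Finset (Fin n) → ℚ) (T : Finset (Fin n)) (hT : T.card = 3) :
    G m T Finset.univ = ∑ l ∈ Tᶜ, m (insert l T) := by
  classical
  unfold G
  symm
  apply Finset.sum_bij (fun l _ => insert l T)
  · intro l hl
    rw [Finset.mem_compl] at hl
    simp [Finset.mem_powersetCard, Finset.card_insert_of_notMem hl, hT]
  · intro a ha b hb hab
    rw [Finset.mem_compl] at ha hb
    have : a ∈ insert b T := hab ▸ Finset.mem_insert_self a T
    rcases Finset.mem_insert.mp this with h | h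
    · exact h
    · exact absurd h ha
  · intro s hs
    simp only [Finset.mem_filter, Finset.mem_powersetCard, Finset.subset_univ, true_and] at hs
    have : (s \ T).card = 1 := by
      rw [Finset.card_sdiff_of_subset hs.2, hs.1, hT]
    obtain ⟨l, hl⟩ := Finset.card_eq_one.mp this
    have hl' : l ∈ s \ T := by rw [hl]; simp
    refine ⟨l, by simpa using (Finset.mem_sdiff.mp hl').2, ?_⟩
    rw [← Finset.sdiff_union_of_subset hs.2, hl]; rfl
  · intros; rfl

/-- The principal minor of `S` on `s`. -/
noncomputable def minor {n : ℕ} (S : Matrix (Fin n) (Fin n) ℚ) (s : Finset (Fin n)) : ℚ :=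
  (S.submatrix (Subtype.val : s → Fin n) (Subtype.val : s → Fin n)).det

lemma minor_map {n k : ℕ} (S : Matrix (Fin n) (Fin n) ℚ) (f : Fin k ↪ Fin n)
    (s : Finset (Fin k)) :
    ((S.submatrix f f).submatrix (Subtype.val : s → Fin k) (Subtype.val : s → Fin k)).det =
      minor S (s.map f) := by
  classical
  unfold minor
  let e : s ≃ (s.map f : Finset (Fin n)) := Equiv.ofBijective
    (fun i => ⟨f i.1, Finset.mem_map_of_mem f i.2⟩) (by
      constructor
      · intro a b hab
        exact Subtype.ext (f.injective (Subtype.ext_iff.mp hab))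
      · rintro ⟨b, hb⟩
        obtain ⟨a, ha, rfl⟩ := Finset.mem_map.mp hb
        exact ⟨⟨a, ha⟩, rfl⟩)
  rw [← Matrix.det_submatrix_equiv_self e]
  rfl

lemma coeff_eq {n k : ℕ} (S : Matrix (Fin n) (Fin n) ℚ) (hk : 4 ≤ k) (f : Fin k ↪ Fin n) :
    (S.submatrix f f).charpoly.coeff (k - 4) = G (minor S) ∅ (Finset.univ.map f) := by
  have h := Matrix.charpoly_coeff_eq_sum_minors (S.submatrix f f) 4 (by simpa using hk)
  rw [Fintype.card_fin] at h
  rw [h]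
  unfold G
  simp only [Finset.empty_subset, Finset.filter_true]
  rw [Finset.powersetCard_map, Finset.sum_map]
  norm_num
  apply Finset.sum_congr rfl
  intro s _
  have := minor_map S f s
  rw [Matrix.submatrix_submatrix] at this
  exact this

lemma det_skew_four (M : Matrix (Fin 4) (Fin 4) ℚ) (h : ∀ i j, M j i = - M i j) :
    M.det = (M 0 1 * M 2 3 - M 0 2 * M 1 3 + M 0 3 * M 1 2) ^ 2 := by
  have hdiag : ∀ i, M i i = 0 := fun i => by have := h i i; linarith
  have s0 : ∀ i : Fin 3, Fin.succAbove (0 : Fin 4) i = ![1, 2, 3] i := by decide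
  have s1 : ∀ i : Fin 3, Fin.succAbove (1 : Fin 4) i = ![0, 2, 3] i := by decide
  have s2 : ∀ i : Fin 3, Fin.succAbove (2 : Fin 4) i = ![0, 1, 3] i := by decide
  have s3 : ∀ i : Fin 3, Fin.succAbove (3 : Fin 4) i = ![0, 1, 2] i := by decide
  have ss : ∀ i : Fin 3, Fin.succ i = ![1, 2, 3] i := by decide
  rw [Matrix.det_succ_row_zero]
  simp only [Fin.sum_univ_four, Matrix.det_fin_three, Matrix.submatrix_apply, s0, s1, s2, s3, ss]
  simp
  rw [h 0 1, h 0 2, h 0 3, h 1 2, h 1 3, h 2 3]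
  simp only [hdiag]
  ring

lemma minor_four {n : ℕ} (S : Matrix (Fin n) (Fin n) ℚ) (hskew : ∀ i j, S j i = - S i j)
    (x y z l : Fin n) (hxy : x ≠ y) (hxz : x ≠ z) (hyz : y ≠ z) (hlx : l ≠ x) (hly : l ≠ y)
    (hlz : l ≠ z) :
    minor S (insert l {x, y, z}) = (S x y * S z l - S x z * S y l + S x l * S y z) ^ 2 := by
  classical
  have hdiag : ∀ i, S i i = 0 := fun i => by have := hskew i i; linarith
  let g : Fin 4 → Fin n := ![x, y, z, l]
  have hg : Function.Injective g := by
    intro a b hab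
    have hlx' := hlx.symm
    have hly' := hly.symm
    have hlz' := hlz.symm
    have hxy' := hxy.symm
    have hxz' := hxz.symm
    have hyz' := hyz.symm
    fin_cases a <;> fin_cases b <;> first | rfl | (exfalso; simp [g] at hab; contradiction)
  have hs : insert l {x, y, z} = (Finset.univ : Finset (Fin 4)).map ⟨g, hg⟩ := by
    ext a
    simp [Fin.exists_fin_succ, g, eq_comm]
    tauto
  rw [hs, ← minor_map]
  have e : ∀ M : Matrix (Fin 4) (Fin 4) ℚ,
      (M.submatrix (Subtype.val : ((Finset.univ : Finset (Fin 4)) : Type) → Fin 4) Subtype.val).det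
        = M.det := fun M =>
    Matrix.det_submatrix_equiv_self (Equiv.subtypeUnivEquiv (fun x => Finset.mem_univ x)) M
  rw [e]
  exact det_skew_four (S.submatrix g g) (fun i j => hskew (g i) (g j))

theorem main_dir {n : ℕ} (hn : 7 ≤ n) (S : Matrix (Fin n) (Fin n) ℚ)
    (hskew : ∀ i j, S j i = - S i j) (hpm : ∀ i j, i ≠ j → S i j = 1 ∨ S i j = -1)
    (hmono : ∀ f g : Fin (n - 3) → Fin n, Function.Injective f → Function.Injective g →
      (S.submatrix f f).charpoly = (S.submatrix g g).charpoly) :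
    (∀ x y z l, x ≠ y → x ≠ z → y ≠ z → l ≠ x → l ≠ y → l ≠ z →
      (S x y * S z l - S x z * S y l + S x l * S y z) ^ 2 = 1) ∨
    (∀ i a, i ≠ a → ∑ b, S i b * S a b = 0) := by
  classical
  have hdiag : ∀ i, S i i = 0 := fun i => by have := hskew i i; linarith
  have hconst : ∃ v, ∀ K : Finset (Fin n), K.card = n - 3 → G (minor S) ∅ K = v := by
    let f0 : Fin (n - 3) ↪ Fin n := Fin.castLEEmb (by omega)
    refine ⟨G (minor S) ∅ (Finset.univ.map f0), fun K hK => ?_⟩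
    let f : Fin (n - 3) ↪ Fin n := (K.orderEmbOfFin hK).toEmbedding
    have hfK : Finset.univ.map f = K := Finset.map_orderEmbOfFin_univ K hK
    rw [← hfK, ← coeff_eq S (by omega) f, ← coeff_eq S (by omega) f0,
      hmono f f0 f.injective f0.injective]
  obtain ⟨v, hv⟩ := G_triple hn _ hconst
  let p : Fin n → Fin n → Fin n → Fin n → ℚ := fun x y z l =>
    S x y * S z l - S x z * S y l + S x l * S y z
  let d : Fin n → Fin n → Fin n → Fin n → ℚ := fun x y z l =>
    if l ∈ ({x, y, z} : Finset (Fin n)) then 0 else p x y z l ^ 2 - 1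
  obtain ⟨w, hw⟩ : ∃ w, ∀ x y z, x ≠ y → x ≠ z → y ≠ z → ∑ l, d x y z l = w := by
    refine ⟨v - ((n : ℚ) - 3), fun x y z hxy hxz hyz => ?_⟩
    have hc : ({x, y, z} : Finset (Fin n)).card = 3 := Finset.card_eq_three.mpr
      ⟨x, y, z, hxy, hxz, hyz, rfl⟩
    rw [← hv x y z hxy hxz hyz, G_triple_eq _ _ hc]
    have h1 : ∑ l, d x y z l = ∑ l ∈ ({x, y, z} : Finset (Fin n))ᶜ, (p x y z l ^ 2 - 1) := by
      simp only [d]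
      rw [← Finset.sum_filter_add_sum_filter_not Finset.univ
        (fun l => l ∈ ({x, y, z} : Finset (Fin n)))]
      rw [Finset.sum_eq_zero, zero_add]
      · apply Finset.sum_congr
        · ext; simp
        · intro l hl
          rw [Finset.mem_compl] at hl
          rw [if_neg hl]
      · intro l hl
        rw [if_pos (Finset.mem_filter.mp hl).2]
    rw [h1, Finset.sum_sub_distrib]
    congr 1
    · apply Finset.sum_congr rfl
      intro l hl
      simp only [Finset.mem_compl, Finset.mem_insert, Finset.mem_singleton, not_or] at hl
      rw [minor_four S hskew x y z l hxy hxz hyz hl.1 hl.2.1 hl.2.2]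
    · rw [Finset.sum_const, Finset.card_compl, hc, Fintype.card_fin, nsmul_eq_mul, mul_one,
        Nat.cast_sub (by omega)]
      norm_num
  have hd0 : ∀ x y z l, x ≠ y → x ≠ z → y ≠ z → 0 ≤ d x y z l := by
    intro x y z l hxy hxz hyz
    simp only [d]
    split_ifs with hl
    · exact le_rfl
    · simp only [Finset.mem_insert, Finset.mem_singleton, not_or] at hl
      simp only [p]
      rcases hpm x y hxy with h1 | h1 <;> rcases hpm x z hxz with h2 | h2 <;>
      rcases hpm y z hyz with h3 | h3 <;> rcases hpm x l (Ne.symm hl.1) with h4 | h4 <;>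
      rcases hpm y l (Ne.symm hl.2.1) with h5 | h5 <;>
      rcases hpm z l (Ne.symm hl.2.2) with h6 | h6 <;> rw [h1, h2, h3, h4, h5, h6] <;> norm_num
  by_cases hw0 : w = 0
  · left
    intro x y z l hxy hxz hyz hlx hly hlz
    have h1 := hw x y z hxy hxz hyz
    rw [hw0, Finset.sum_eq_zero_iff_of_nonneg (fun l _ => hd0 x y z l hxy hxz hyz)] at h1
    have h2 := h1 l (Finset.mem_univ _)
    simp only [d, Finset.mem_insert, Finset.mem_singleton, hlx, hly, hlz, or_false, if_false] at h2
    show p x y z l ^ 2 = 1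
    linarith
  · right
    intro i a hia
    have h1 : ∑ b, ∑ c, S i b * S a b * d i a b c = w * ∑ b, S i b * S a b := by
      rw [Finset.mul_sum]
      apply Finset.sum_congr rfl
      intro b _
      by_cases hib : i = b
      · subst hib; simp [hdiag]
      by_cases hab : a = b
      · subst hab; simp [hdiag]
      rw [← Finset.mul_sum, hw i a b hia hib hab]; ring
    have hanti : ∀ b c, S i b * S a b * d i a b c = - (S i c * S a c * d i a c b) := by
      intro b c
      by_cases hib : i = b
      · subst hib; simp [hdiag, d]
      by_cases hab : a = b
      · subst hab; simp [hdiag, d]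
      by_cases hic : i = c
      · subst hic; simp [hdiag, d]
      by_cases hac : a = c
      · subst hac; simp [hdiag, d]
      by_cases hbc : b = c
      · subst hbc; simp [d]
      simp only [d, Finset.mem_insert, Finset.mem_singleton, Ne.symm hib, Ne.symm hab,
        Ne.symm hic, Ne.symm hac, Ne.symm hbc, hbc, or_false, if_false, p]
      rw [hskew b c]
      rcases hpm i a hia with h1 | h1 <;> rcases hpm i b hib with h2 | h2 <;>
      rcases hpm a b hab with h3 | h3 <;> rcases hpm i c hic with h4 | h4 <;>
      rcases hpm a c hac with h5 | h5 <;>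
      rcases hpm b c hbc with h6 | h6 <;> rw [h1, h2, h3, h4, h5, h6] <;> norm_num
    have h2 : ∑ b, ∑ c, S i b * S a b * d i a b c =
        - ∑ b, ∑ c, S i b * S a b * d i a b c := by
      conv_lhs => rw [Finset.sum_comm]
      rw [← Finset.sum_neg_distrib]
      apply Finset.sum_congr rfl
      intro b _
      rw [← Finset.sum_neg_distrib]
      apply Finset.sum_congr rfl
      intro c _
      exact hanti c b
    have h3 : w * ∑ b, S i b * S a b = 0 := by rw [← h1]; linarith
    exact (mul_eq_zero.mp h3).resolve_left hw0

theorem switch_of_no_diamond {n : ℕ} (hn : 7 ≤ n) (A : Matrix (Fin n) (Fin n) ℚ)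
    (hskew : ∀ i j, (A - Aᵀ) j i = - (A - Aᵀ) i j)
    (hpm : ∀ i j, i ≠ j → (A - Aᵀ) i j = 1 ∨ (A - Aᵀ) i j = -1)
    (h : ∀ x y z l, x ≠ y → x ≠ z → y ≠ z → l ≠ x → l ≠ y → l ≠ z →
      ((A - Aᵀ) x y * (A - Aᵀ) z l - (A - Aᵀ) x z * (A - Aᵀ) y l
        + (A - Aᵀ) x l * (A - Aᵀ) y z) ^ 2 = 1) :
    SwitchEquivTransitive A := by
  classical
  generalize hS : A - Aᵀ = S at *
  have hdiag : ∀ i, S i i = 0 := fun i => by have := hskew i i; linarith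
  let o : Fin n := ⟨0, by omega⟩
  let ε : Fin n → ℚ := fun x => if x = o then 1 else S o x
  have hε : ∀ i, ε i = 1 ∨ ε i = -1 := by
    intro i
    simp only [ε]
    split_ifs with hi
    · left; rfl
    · exact hpm _ _ (Ne.symm hi)
  let R : Fin n → Fin n → ℚ := fun i j => ε i * S i j * ε j
  have hRskew : ∀ i j, R j i = - R i j := by
    intro i j; simp only [R]; rw [hskew i j]; ring
  have hRpm : ∀ i j, i ≠ j → R i j = 1 ∨ R i j = -1 := by
    intro i j hij
    simp only [R]
    rcases hε i with h1 | h1 <;> rcases hε j with h2 | h2 <;> rcases hpm i j hij with h3 | h3 <;>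
      rw [h1, h2, h3] <;> norm_num
  have hR0 : ∀ j, j ≠ o → R o j = 1 := by
    intro j hj
    simp only [R, ε, if_true, if_neg hj]
    rcases hpm o j (Ne.symm hj) with h3 | h3 <;> rw [h3] <;> norm_num
  have hcyc : ∀ i j k, i ≠ o → j ≠ o → k ≠ o → i ≠ j → i ≠ k → j ≠ k →
      ¬ (R i j = 1 ∧ R j k = 1 ∧ R i k = -1) := by
    rintro i j k hi hj hk hij hik hjk ⟨h1, h2, h3⟩
    have hh := h o i j k (Ne.symm hi) (Ne.symm hj) hij hk (Ne.symm hik) (Ne.symm hjk)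
    simp only [R, ε, if_neg hi, if_neg hj, if_neg hk] at h1 h2 h3
    revert h1 h2 h3 hh
    rcases hpm o i (Ne.symm hi) with g1 | g1 <;> rcases hpm o j (Ne.symm hj) with g2 | g2 <;>
    rcases hpm o k (Ne.symm hk) with g3 | g3 <;> rcases hpm i j hij with g4 | g4 <;>
    rcases hpm i k hik with g5 | g5 <;> rcases hpm j k hjk with g6 | g6 <;>
    rw [g1, g2, g3, g4, g5, g6] <;> norm_num
  let B : Matrix (Fin n) (Fin n) ℚ := Matrix.of fun i j => if i = j then 0 else (1 + R i j) / 2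
  have hB1 : ∀ i j, B i j = 1 → i ≠ j ∧ R i j = 1 := by
    intro i j hb
    simp only [B, Matrix.of_apply] at hb
    split_ifs at hb with hij
    · norm_num at hb
    · exact ⟨hij, by linarith⟩
  refine ⟨ε, hε, B, ⟨?_, ?_, ?_⟩, ?_, ?_⟩
  · intro i j
    simp only [B, Matrix.of_apply]
    split_ifs with hij
    · left; rfl
    · rcases hRpm i j hij with h1 | h1 <;> rw [h1] <;> norm_num
  · intro i; simp [B]
  · ext i j
    by_cases hij : i = j
    · subst hij; simp [B]
    · simp only [B, Matrix.add_apply, Matrix.transpose_apply, Matrix.of_apply, if_neg hij,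
        if_neg (Ne.symm hij), Matrix.sub_apply, Matrix.one_apply_ne hij]
      rw [hRskew i j]; ring
  · intro i j k h1 h2
    obtain ⟨hij, h1⟩ := hB1 _ _ h1
    obtain ⟨hjk, h2⟩ := hB1 _ _ h2
    have hno : ∀ a b, a ≠ b → R a b = 1 → b ≠ o := by
      rintro a b hab hr rfl
      have := hRskew a o
      rw [hR0 a hab, hr] at this
      norm_num at this
    have hj := hno _ _ hij h1
    have hk := hno _ _ hjk h2
    have hik : i ≠ k := by
      rintro rfl
      have := hRskew i j
      rw [h1, h2] at this
      norm_num at this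
    have hr : R i k = 1 := by
      by_cases hi : i = o
      · rw [hi]; exact hR0 k hk
      · rcases hRpm i k hik with h3 | h3
        · exact h3
        · exact absurd ⟨h1, h2, h3⟩ (hcyc i j k hi hj hk hij hik hjk)
    simp only [B, Matrix.of_apply, if_neg hik, hr]
    norm_num
  · rw [hS]
    ext i j
    simp only [Matrix.mul_diagonal, Matrix.diagonal_mul, Matrix.sub_apply, Matrix.transpose_apply,
      B, Matrix.of_apply]
    by_cases hij : i = j
    · subst hij; simp [hdiag]
    · rw [if_neg hij, if_neg (Ne.symm hij), hRskew i j]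
      simp only [R]; ring

end SkewMono

open SkewMono

theorem stmt_14 (n : ℕ) (hn : 7 ≤ n)
    (A : Matrix (Fin n) (Fin n) ℚ) (hT : IsTournament A) :
    SkewSpecMono (n - 3) A ↔
      (SwitchEquivTransitive A ∨
        (A - Aᵀ)ᵀ * (A - Aᵀ) = ((n : ℚ) - 1) • (1 : Matrix (Fin n) (Fin n) ℚ)) := by
  have hskew : ∀ i j, (A - Aᵀ) j i = - (A - Aᵀ) i j := by
    intro i j; simp
  have hpm : ∀ i j, i ≠ j → (A - Aᵀ) i j = 1 ∨ (A - Aᵀ) i j = -1 := by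
    intro i j hij
    have h := tour_sum hT hij
    simp only [Matrix.sub_apply, Matrix.transpose_apply]
    rcases hT.1 i j with h0 | h0
    · right; linarith
    · left; linarith
  have hST : (A - Aᵀ)ᵀ = -(A - Aᵀ) := by simp
  have hsq : ∀ i j, i ≠ j → (A - Aᵀ) i j * (A - Aᵀ) i j = 1 := by
    intro i j hij
    rcases hpm i j hij with h | h <;> rw [h] <;> norm_num
  constructor
  · intro hmono
    rcases main_dir hn (A - Aᵀ) hskew hpm hmono with h | h
    · left; exact switch_of_no_diamond hn A hskew hpm h
    · right
      have hh : (A - Aᵀ)ᵀ * (A - Aᵀ) = (A - Aᵀ) * (A - Aᵀ)ᵀ := by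
        rw [hST, neg_mul, mul_neg]
      rw [hh]
      ext i a
      rw [Matrix.mul_apply, Matrix.smul_apply]
      by_cases hia : i = a
      · subst hia
        have h1 : ∀ b, (A - Aᵀ) i b * (A - Aᵀ)ᵀ b i = if b = i then 0 else 1 := by
          intro b
          rw [Matrix.transpose_apply]
          split_ifs with hb
          · subst hb; simp
          · exact hsq _ _ (Ne.symm hb)
        rw [Finset.sum_congr rfl fun b _ => h1 b, Matrix.one_apply_eq, Finset.sum_ite]
        simp [Finset.filter_ne', Finset.card_erase_of_mem]
        rw [Nat.cast_sub (by omega)]; norm_num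
      · rw [Matrix.one_apply_ne hia, smul_zero]
        exact h i a hia
  · rintro (h | h) f g hf hg
    · rw [switch_charpoly h f hf, switch_charpoly h g hg]
    · have hC : (A - Aᵀ) * (A - Aᵀ) = -(((n : ℚ) - 1) • (1 : Matrix (Fin n) (Fin n) ℚ)) := by
        rw [← h, hST, neg_mul, neg_neg]
      have h1 := conf_charpoly (k := n - 3) (by omega) _ hskew hsq hC f hf
      have h2 := conf_charpoly (k := n - 3) (by omega) _ hskew hsq hC g hg
      have hq : (X ^ 2 + C ((n : ℚ) - 1) : ℚ[X]) ^ 3 ≠ 0 :=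
        pow_ne_zero _ (Polynomial.Monic.ne_zero (Polynomial.monic_X_pow_add_C _ (by norm_num)))
      exact mul_right_cancel₀ hq (h1.trans h2.symm)
end
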